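/- Let F ∈ S^♯♭(σ0,σ1) be such that 0 ∉ Z(F). Then for every s ∈ ℂ that is not a non-trivial zero of F, the symmetric limit lim_{T→∞} ∑_{ρ∈Z(F), |Im ρ|≤T} ord(ρ)/(s−ρ) exists and equals ξ_F′(s)/ξ_F(s). -/

import Mathlib

open Complex Filter MeasureTheory Finset

noncomputable section

/-- The order of vanishing of `f` at `ρ`. -/
noncomputable def zeroOrder (f : ℂ → ℂ) (ρ : ℂ) : ℕ :=
  sInf {k : ℕ | iteratedDeriv k f ρ ≠ 0}

/-- The class `S^♯♭(σ₀,σ₁)` of `L`-functions. -/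
structure SSF (σ0 σ1 : ℝ) : Type where
  hσ1pos : 0 < σ1
  hσ : σ1 ≤ σ0
  /-- The `L`-function itself (as a function, analytic away from the poles). -/
  F : ℂ → ℂ
  /-- Dirichlet series coefficients. -/
  a : ℕ → ℂ
  hDir : ∀ s : ℂ, σ0 < s.re →
    HasSum (fun n : ℕ => a (n + 1) * ((n + 1 : ℕ) : ℂ) ^ (-s)) (F s)
  hDirAbs : ∀ s : ℂ, σ0 < s.re →
    Summable (fun n : ℕ => ‖a (n + 1) * ((n + 1 : ℕ) : ℂ) ^ (-s)‖)
  /-- The number of poles. -/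
  N : ℕ
  /-- The poles `s₁, …, s_N`. -/
  pole : Fin N → ℂ
  /-- Their orders `m₁, …, m_N`. -/
  m : Fin N → ℕ
  hm : ∀ i, 0 < m i
  /-- Entire continuation of `∏ (s - sᵢ)^{mᵢ} · F s`, of finite order. -/
  G : ℂ → ℂ
  hGdiff : Differentiable ℂ G
  hGord : ∃ c B : ℝ, ∀ s : ℂ, ‖G s‖ ≤ c * Real.exp (‖s‖ ^ B)
  hGF : ∀ s : ℂ, (∀ i, s ≠ pole i) → G s = (∏ i, (s - pole i) ^ m i) * F s
  Q : ℝ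
  hQ : 0 < Q
  r : ℕ
  lam : Fin r → ℝ
  hlam : ∀ j, 0 < lam j
  mu : Fin r → ℂ
  ω : ℂ
  hω : ‖ω‖ = 1
  M : ℕ
  /-- `δ(σ₁) ∈ {0,1}`. -/
  dlt : ℕ
  hdlt : dlt ≤ 1
  hMN : 2 * M + dlt ≤ N
  hpair : ∀ (j : ℕ) (h1 : 2 * j < N) (h2 : 2 * j + 1 < N), j < M →
    pole ⟨2 * j, h1⟩ + (starRingEnd ℂ) (pole ⟨2 * j + 1, h2⟩) = (σ1 : ℂ)
  hdelta : dlt = 1 ↔ ∃ i, pole i = (σ1 / 2 : ℂ)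
  hdeltaPos : dlt = 1 → ∀ h2 : 2 * M < N, pole ⟨2 * M, h2⟩ = (σ1 / 2 : ℂ)
  /-- The completed function `ξ_F` (the analytic continuation of the completed product). -/
  xi : ℂ → ℂ
  hxiDiff : Differentiable ℂ xi
  hxiEq : ∀ s : ℂ, (∀ i, s ≠ pole i) →
    (∀ (j : Fin r) (k : ℕ), (lam j : ℂ) * s + mu j ≠ -(k : ℂ)) →
    xi s = F s * (Q : ℂ) ^ s * (∏ j, Complex.Gamma ((lam j : ℂ) * s + mu j)) *
      (∏ i, (s - pole i) ^ m i) *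
      ∏ i : Fin N, (if 2 * M + dlt ≤ (i : ℕ) then ((σ1 : ℂ) - s - (starRingEnd ℂ) (pole i)) ^ m i else 1)
  hFE : ∀ s : ℂ, xi s = ω * (starRingEnd ℂ) (xi ((σ1 : ℂ) - (starRingEnd ℂ) s))
  /-- The coefficients of the Dirichlet series of `-F'/F`. -/
  c : ℕ → ℂ
  hEuler : ∀ s : ℂ, σ0 < s.re →
    HasSum (fun n : ℕ => c (n + 2) * ((n + 2 : ℕ) : ℂ) ^ (-s)) (-(deriv F s / F s))
  hEulerAbs : ∀ s : ℂ, σ0 < s.re →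
    Summable (fun n : ℕ => ‖c (n + 2) * ((n + 2 : ℕ) : ℂ) ^ (-s)‖)

namespace SSF

variable {σ0 σ1 : ℝ}

/-- Truncated sum over the nontrivial zeros (zeros of `ξ_F`) with `|Im ρ| ≤ T`,
counted with multiplicity. -/
noncomputable def zsum (S : SSF σ0 σ1) (w : ℂ → ℂ) (T : ℝ) : ℂ :=
  ∑' ρ : {ρ : ℂ // S.xi ρ = 0 ∧ |ρ.im| ≤ T}, (zeroOrder S.xi ρ : ℂ) * w ρ

end SSF

section

open scoped Real Topology

section LocalFactorization

variable {f : ℂ → ℂ}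

lemma analyticOrderAt_ne_top_of_entire (hf : Differentiable ℂ f) (hne : ∃ z, f z ≠ 0) (ρ : ℂ) :
    analyticOrderAt f ρ ≠ ⊤ := by
  intro h
  obtain ⟨z, hz⟩ := hne
  rw [analyticOrderAt_eq_top] at h
  have hA : AnalyticOnNhd ℂ f Set.univ := fun w _ => hf.analyticAt w
  exact hz (hA.eqOn_zero_of_preconnected_of_eventuallyEq_zero isPreconnected_univ
    (Set.mem_univ ρ) h (Set.mem_univ z))

lemma coe_zeroOrder (hf : Differentiable ℂ f) (hne : ∃ z, f z ≠ 0) (ρ : ℂ) :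
    ((zeroOrder f ρ : ℕ) : ℕ∞) = analyticOrderAt f ρ := by
  obtain ⟨n, hn⟩ := ENat.ne_top_iff_exists.mp (analyticOrderAt_ne_top_of_entire hf hne ρ)
  have h := (analyticOrderAt_eq_nat_iff_iteratedDeriv_eq_zero (hf.analyticAt ρ)).mp hn.symm
  rw [← hn]
  congr 1
  apply le_antisymm
  · exact Nat.sInf_le h.2
  · refine le_csInf ⟨n, h.2⟩ fun k hk => ?_
    by_contra hlt
    exact hk (h.1 k (not_le.mp hlt))

lemma zeroOrder_pos (hf : Differentiable ℂ f) (hne : ∃ z, f z ≠ 0) {ρ : ℂ} (h : f ρ = 0) :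
    0 < zeroOrder f ρ := by
  have h1 := coe_zeroOrder hf hne ρ
  have h2 := (hf.analyticAt ρ).analyticOrderAt_ne_zero.mpr h
  rw [← h1] at h2
  exact Nat.pos_of_ne_zero (by exact_mod_cast h2)

lemma exists_eq_pow_mul_of_analyticOrderAt (hf : Differentiable ℂ f) {ρ : ℂ} {n : ℕ}
    (h : analyticOrderAt f ρ = n) :
    ∃ g : ℂ → ℂ, Differentiable ℂ g ∧ (∀ z, f z = (z - ρ) ^ n * g z) ∧ g ρ ≠ 0 := by
  classical
  obtain ⟨g, hg, hgρ, hfg⟩ := ((hf.analyticAt ρ).analyticOrderAt_eq_natCast).mp h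
  refine ⟨fun z => if z = ρ then g ρ else f z / (z - ρ) ^ n, ?_, ?_, by simpa using hgρ⟩
  · intro z
    by_cases hz : z = ρ
    · subst hz
      refine hg.differentiableAt.congr_of_eventuallyEq ?_
      filter_upwards [hfg] with w hw
      split_ifs with hwz
      · rw [hwz]
      · rw [hw, smul_eq_mul, mul_div_cancel_left₀ _ (pow_ne_zero _ (sub_ne_zero.mpr hwz))]
    · have : DifferentiableAt ℂ (fun w => f w / (w - ρ) ^ n) z :=
        (hf z).div (by fun_prop) (pow_ne_zero _ (sub_ne_zero.mpr hz))
      refine this.congr_of_eventuallyEq ?_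
      filter_upwards [isOpen_ne.mem_nhds hz] with w hw
      exact if_neg hw
  · intro z
    dsimp only
    split_ifs with hz
    · subst hz
      simpa using hfg.self_of_nhds
    · rw [mul_div_cancel₀ _ (pow_ne_zero _ (sub_ne_zero.mpr hz))]

lemma exists_eq_prod_mul (hf : Differentiable ℂ f) (hne : ∃ z, f z ≠ 0) (S : Finset ℂ) :
    ∃ g : ℂ → ℂ, Differentiable ℂ g ∧
      (∀ z, f z = (∏ ρ ∈ S, (z - ρ) ^ zeroOrder f ρ) * g z) ∧ ∀ ρ ∈ S, g ρ ≠ 0 := by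
  classical
  induction S using Finset.induction_on with
  | empty => exact ⟨f, hf, by simp, by simp⟩
  | insert a S ha ih =>
    obtain ⟨g, hg, hfg, hgS⟩ := ih
    have hP : Differentiable ℂ (fun z => ∏ ρ ∈ S, (z - ρ) ^ zeroOrder f ρ) := by fun_prop
    have hPa : (∏ ρ ∈ S, (a - ρ) ^ zeroOrder f ρ) ≠ 0 :=
      Finset.prod_ne_zero_iff.mpr fun ρ hρ =>
        pow_ne_zero _ (sub_ne_zero.mpr fun h => ha (h ▸ hρ))
    have hord : analyticOrderAt g a = (zeroOrder f a : ℕ) := by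
      rw [coe_zeroOrder hf hne a]
      have : f = (fun z => ∏ ρ ∈ S, (z - ρ) ^ zeroOrder f ρ) * g := funext hfg
      conv_rhs => rw [this]
      rw [analyticOrderAt_mul (hP.analyticAt a) (hg.analyticAt a),
        (hP.analyticAt a).analyticOrderAt_eq_zero.mpr hPa, zero_add]
    obtain ⟨g1, hg1, hgg1, hg1a⟩ := exists_eq_pow_mul_of_analyticOrderAt hg hord
    refine ⟨g1, hg1, fun z => ?_, fun ρ hρ => ?_⟩
    · rw [Finset.prod_insert ha, hfg z, hgg1 z]; ring
    · rcases Finset.mem_insert.mp hρ with rfl | hρ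
      · exact hg1a
      · intro h0
        exact hgS ρ hρ (by rw [hgg1, h0, mul_zero])

lemma logDeriv_eq_sum_add {g : ℂ → ℂ} {S : Finset ℂ} {m : ℂ → ℕ} (hg : Differentiable ℂ g)
    (hfg : ∀ z, f z = (∏ ρ ∈ S, (z - ρ) ^ m ρ) * g z) {z : ℂ} (hz : f z ≠ 0)
    (hzS : ∀ ρ ∈ S, z ≠ ρ) :
    logDeriv f z = ∑ ρ ∈ S, (m ρ : ℂ) / (z - ρ) + logDeriv g z := by
  have hgz : g z ≠ 0 := fun h => hz (by rw [hfg, h, mul_zero])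
  have hP : (∏ ρ ∈ S, (z - ρ) ^ m ρ) ≠ 0 := fun h => hz (by rw [hfg, h, zero_mul])
  have : f = fun z => (∏ ρ ∈ S, (z - ρ) ^ m ρ) * g z := funext hfg
  rw [this, logDeriv_mul z hP hgz (by fun_prop) (hg z), logDeriv_prod]
  · congr 1
    refine Finset.sum_congr rfl fun ρ hρ => ?_
    rw [logDeriv_fun_pow (by fun_prop)]
    simp [logDeriv_apply, div_eq_mul_inv]
  · exact fun ρ hρ => pow_ne_zero _ (sub_ne_zero.mpr (hzS ρ hρ))
  · intro ρ _; fun_prop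

/-- A Borel–Carathéodory bound for the logarithmic derivative of a zero-free function. -/
lemma norm_logDeriv_le_of_ball {g : ℂ → ℂ} {z₀ : ℂ} {R M : ℝ} (hR : 0 < R) (hM : 1 < M)
    (hg : DifferentiableOn ℂ g (Metric.ball z₀ R)) (hg0 : ∀ z ∈ Metric.ball z₀ R, g z ≠ 0)
    (hb : ∀ z ∈ Metric.ball z₀ R, ‖g z‖ ≤ M * ‖g z₀‖) {z : ℂ}
    (hz : z ∈ Metric.closedBall z₀ (R / 2)) :
    ‖logDeriv g z‖ ≤ 24 * Real.log M / R := by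
  have hopen : IsOpen (Metric.ball z₀ R) := Metric.isOpen_ball
  have hz0 : z₀ ∈ Metric.ball z₀ R := Metric.mem_ball_self hR
  have hlog : 0 < Real.log M := Real.log_pos hM
  have hd : DifferentiableOn ℂ (fun w => deriv g w / g w) (Metric.ball z₀ R) :=
    (hg.deriv hopen).div hg hg0
  obtain ⟨h, hh0, hh⟩ := hd.isExactOn_ball.with_val_at z₀ 0
  have hdiff : ∀ w ∈ Metric.ball z₀ R, HasDerivAt (fun w => g w * cexp (-h w)) 0 w := by
    intro w hw
    have h1 := (hg.differentiableAt (hopen.mem_nhds hw)).hasDerivAt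
    have h2 := h1.mul ((hh w hw).neg.cexp)
    refine h2.congr_deriv ?_
    rw [show g w * (cexp ((-h) w) * -(deriv g w / g w)) =
      -(cexp ((-h) w) * deriv g w) * (g w / g w) by ring, div_self (hg0 w hw)]
    ring
  have hconst : ∀ w ∈ Metric.ball z₀ R, g w * cexp (-h w) = g z₀ := by
    intro w hw
    have := hopen.is_const_of_deriv_eq_zero (convex_ball z₀ R).isPreconnected
      (fun x hx => (hdiff x hx).differentiableAt.differentiableWithinAt)
      (fun x hx => (hdiff x hx).deriv) hw hz0
    simpa [hh0] using this
  have hre : ∀ w ∈ Metric.ball z₀ R, (h w).re ≤ Real.log M := by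
    intro w hw
    have h1 : ‖g w‖ * Real.exp (-(h w).re) = ‖g z₀‖ := by
      rw [← hconst w hw, norm_mul, Complex.norm_exp, Complex.neg_re]
    have h2 : ‖g w‖ = ‖g z₀‖ * Real.exp ((h w).re) := by
      rw [← h1, mul_assoc, ← Real.exp_add]; simp
    have h3 := hb w hw
    rw [h2, mul_comm] at h3
    have h4 := le_of_mul_le_mul_right h3 (norm_pos_iff.mpr (hg0 z₀ hz0))
    rwa [Real.le_log_iff_exp_le (by linarith)]
  have hBC : ∀ w, ‖w‖ ≤ 3 * R / 4 → ‖h (z₀ + w)‖ ≤ 6 * Real.log M := by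
    intro w hw
    have hmaps : Set.MapsTo (fun w => z₀ + w) (Metric.ball 0 R) (Metric.ball z₀ R) := by
      intro x hx; simpa using hx
    have hdh : DifferentiableOn ℂ h (Metric.ball z₀ R) :=
      fun x hx => (hh x hx).differentiableAt.differentiableWithinAt
    have h1 := Complex.borelCaratheodory_zero (f := fun w => h (z₀ + w)) (z := w) hlog
      (hdh.comp (by fun_prop) hmaps) (fun x hx => hre _ (hmaps hx)) hR
      (by simp; linarith) (by simpa using hh0)
    refine h1.trans ?_
    rw [div_le_iff₀ (by linarith)]
    nlinarith
  have hzb : ∀ w ∈ Metric.closedBall z (R / 4), ‖w - z₀‖ ≤ 3 * R / 4 := by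
    intro w hw
    rw [Metric.mem_closedBall, dist_eq_norm] at hw hz
    calc ‖w - z₀‖ = ‖(w - z) + (z - z₀)‖ := by ring_nf
      _ ≤ R / 4 + R / 2 := (norm_add_le _ _).trans (add_le_add hw hz)
      _ = 3 * R / 4 := by ring
  have hsub : Metric.closedBall z (R / 4) ⊆ Metric.ball z₀ R := by
    intro w hw
    rw [Metric.mem_ball, dist_eq_norm]
    linarith [hzb w hw]
  have hder : deriv h z = logDeriv g z := by
    rw [logDeriv_apply]
    exact (hh z (hsub (Metric.mem_closedBall_self (by linarith)))).deriv
  rw [← hder]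
  have hdc : DiffContOnCl ℂ h (Metric.ball z (R / 4)) := by
    apply DifferentiableOn.diffContOnCl
    rw [closure_ball z (by linarith)]
    exact fun x hx => (hh x (hsub hx)).differentiableAt.differentiableWithinAt
  refine (Complex.norm_deriv_le_of_forall_mem_sphere_norm_le (C := 6 * Real.log M)
    (by linarith : 0 < R / 4) hdc fun w hw => ?_).trans (le_of_eq ?_)
  · have := hBC (w - z₀) (hzb w (Metric.sphere_subset_closedBall hw))
    simpa using this
  · field_simp; ring

lemma finite_zeros_of_isCompact (hf : Differentiable ℂ f) (hne : ∃ z, f z ≠ 0) {K : Set ℂ}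
    (hK : IsCompact K) : {z | f z = 0 ∧ z ∈ K}.Finite := by
  by_contra hinf
  obtain ⟨z, -, hz⟩ := Set.Infinite.exists_accPt_of_subset_isCompact (K := K) hinf hK
    fun x hx => hx.2
  apply analyticOrderAt_ne_top_of_entire hf hne z
  rw [analyticOrderAt_eq_top]
  refine ((hf.analyticAt z).eventually_eq_zero_or_eventually_ne_zero).resolve_right fun h => ?_
  have h1 := accPt_iff_frequently_nhdsNE.mp hz
  exact h1 (h.mono fun x hx hx' => hx hx'.1)

/-- Zero counting and partial fractions of the logarithmic derivative on a disc. -/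
lemma local_zeros_and_logDeriv (hf : Differentiable ℂ f) {z₀ : ℂ} (h0 : f z₀ ≠ 0) {K M : ℝ}
    (hK : 0 < K) (hM : 1 < M) (hb : ∀ z ∈ Metric.closedBall z₀ (8 * K), ‖f z‖ ≤ M * ‖f z₀‖)
    {S : Finset ℂ} (hS : ∀ ρ, ρ ∈ S ↔ f ρ = 0 ∧ ρ ∈ Metric.closedBall z₀ (2 * K)) :
    (∑ ρ ∈ S, (zeroOrder f ρ : ℝ) ≤ Real.log M) ∧
    ∀ z ∈ Metric.closedBall z₀ K, f z ≠ 0 →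
      ‖logDeriv f z - ∑ ρ ∈ S, (zeroOrder f ρ : ℂ) / (z - ρ)‖ ≤ 12 * Real.log M / K := by
  obtain ⟨g, hg, hfg, hgS⟩ := exists_eq_prod_mul hf ⟨z₀, h0⟩ S
  set n := ∑ ρ ∈ S, zeroOrder f ρ with hn
  have hgz0 : g z₀ ≠ 0 := fun h => h0 (by rw [hfg, h, mul_zero])
  have hgpos : 0 < ‖g z₀‖ := norm_pos_iff.mpr hgz0
  have hup : ‖f z₀‖ ≤ (2 * K) ^ n * ‖g z₀‖ := by
    rw [hfg z₀, norm_mul, norm_prod, hn, ← Finset.prod_pow_eq_pow_sum]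
    gcongr with ρ hρ
    rw [norm_pow]
    gcongr
    have := ((hS ρ).mp hρ).2
    rw [Metric.mem_closedBall, dist_comm, dist_eq_norm] at this
    exact this
  have hlow : ∀ z ∈ Metric.sphere z₀ (8 * K), (6 * K) ^ n * ‖g z‖ ≤ ‖f z‖ := by
    intro z hz
    rw [hfg z, norm_mul, norm_prod, hn, ← Finset.prod_pow_eq_pow_sum]
    gcongr with ρ hρ
    rw [norm_pow]
    gcongr
    have h1 := ((hS ρ).mp hρ).2
    rw [Metric.mem_closedBall] at h1
    rw [Metric.mem_sphere] at hz
    rw [← dist_eq_norm]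
    linarith [dist_triangle z ρ z₀]
  have hgM : ∀ z ∈ Metric.closedBall z₀ (8 * K), 3 ^ n * ‖g z‖ ≤ M * ‖g z₀‖ := by
    intro z hz
    have hcl : closure (Metric.ball z₀ (8 * K)) = Metric.closedBall z₀ (8 * K) :=
      closure_ball z₀ (by linarith)
    have hfr : frontier (Metric.ball z₀ (8 * K)) = Metric.sphere z₀ (8 * K) :=
      frontier_ball z₀ (by linarith)
    have key : ‖g z‖ ≤ M * ‖g z₀‖ / 3 ^ n := by
      refine Complex.norm_le_of_forall_mem_frontier_norm_le (U := Metric.ball z₀ (8 * K))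
        Metric.isBounded_ball hg.diffContOnCl (fun w hw => ?_) (hcl ▸ hz)
      rw [hfr] at hw
      rw [le_div_iff₀ (by positivity)]
      have h1 := hlow w hw
      have h2 := hb w (Metric.sphere_subset_closedBall hw)
      have h3 : (6 * K) ^ n * ‖g w‖ ≤ M * ((2 * K) ^ n * ‖g z₀‖) :=
        h1.trans (h2.trans (by gcongr))
      have h4 : (6 * K) ^ n = 3 ^ n * (2 * K) ^ n := by rw [← mul_pow]; ring_nf
      rw [h4] at h3
      have h5 : 0 < (2 * K) ^ n := by positivity
      refine le_of_mul_le_mul_left ?_ h5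
      linarith
    rw [le_div_iff₀ (by positivity)] at key
    linarith
  have h3n : (3 : ℝ) ^ n ≤ M :=
    le_of_mul_le_mul_right (hgM z₀ (Metric.mem_closedBall_self (by linarith))) hgpos
  refine ⟨?_, fun z hz hfz => ?_⟩
  · have h1 := Real.log_le_log (by positivity) h3n
    rw [Real.log_pow] at h1
    have h2 : (1 : ℝ) ≤ Real.log 3 := by
      rw [Real.le_log_iff_exp_le (by norm_num)]
      linarith [Real.exp_one_lt_d9]
    have h3 : (n : ℝ) ≤ n * Real.log 3 := le_mul_of_one_le_right (Nat.cast_nonneg _) h2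
    have h4 : ∑ ρ ∈ S, (zeroOrder f ρ : ℝ) = n := by rw [hn]; push_cast; rfl
    linarith
  · have hzS : ∀ ρ ∈ S, z ≠ ρ := fun ρ hρ h => hfz (h ▸ ((hS ρ).mp hρ).1)
    rw [logDeriv_eq_sum_add hg hfg hfz hzS, add_sub_cancel_left]
    have hball : Metric.ball z₀ (2 * K) ⊆ Metric.closedBall z₀ (8 * K) :=
      Metric.ball_subset_closedBall.trans (Metric.closedBall_subset_closedBall (by linarith))
    have := norm_logDeriv_le_of_ball (g := g) (z₀ := z₀) (R := 2 * K) (M := M) (z := z)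
      (by linarith) hM hg.differentiableOn ?_ ?_ ?_
    · refine this.trans (le_of_eq ?_)
      field_simp; ring
    · intro w hw hgw
      have hfw : f w = 0 := by rw [hfg, hgw, mul_zero]
      exact hgS w ((hS w).mpr ⟨hfw, Metric.ball_subset_closedBall hw⟩) hgw
    · intro w hw
      refine le_trans ?_ (hgM w (hball hw))
      exact le_mul_of_one_le_left (norm_nonneg _) (one_le_pow₀ (by norm_num))
    · rw [mul_div_cancel_left₀ _ (two_ne_zero)]; exact hz

end LocalFactorization

/-- Entire functions with a functional equation `s ↦ σ - conj s` that do not vanish on `A ≤ Re s`,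
have polynomially bounded local variation there, and whose values at conjugate points are
polynomially comparable. -/
structure TemperedFE (f : ℂ → ℂ) (σ A : ℝ) (ω : ℂ) : Prop where
  differentiable : Differentiable ℂ f
  norm_eq_one : ‖ω‖ = 1
  fe : ∀ s, f s = ω * (starRingEnd ℂ) (f ((σ : ℂ) - (starRingEnd ℂ) s))
  sigma_pos : 0 < σ
  one_le : 1 ≤ A
  sigma_le : σ ≤ A
  ne_zero : ∀ z : ℂ, A ≤ z.re → f z ≠ 0
  ratio : ∀ K : ℝ, ∃ k : ℕ, ∀ z₀ z : ℂ, A ≤ z₀.re → ‖z - z₀‖ ≤ K →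
    ‖f z‖ ≤ (2 + ‖z₀‖) ^ k * ‖f z₀‖
  conj_ratio : ∃ k : ℕ, ∀ z : ℂ, A ≤ z.re → ‖f z‖ ≤ (2 + ‖z‖) ^ k * ‖f ((starRingEnd ℂ) z)‖

lemma log_two_add_pos {x : ℝ} (hx : 0 ≤ x) : 0 < Real.log (2 + x) :=
  Real.log_pos (by linarith)

lemma half_le_log_two_add {x : ℝ} (hx : 0 ≤ x) : 1 / 2 ≤ Real.log (2 + x) := by
  have h1 := Real.log_le_log (by norm_num) (by linarith : (2 : ℝ) ≤ 2 + x)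
  linarith [Real.log_two_gt_d9]

lemma log_two_add_le {a x y : ℝ} (ha : 0 ≤ a) (hx : 0 ≤ x) (hy : 0 ≤ y) (h : x ≤ y + a) :
    Real.log (2 + x) ≤ (1 + 2 * a) * Real.log (2 + y) := by
  have h1 : Real.log (2 + x) ≤ Real.log ((2 + y) * (1 + a)) :=
    Real.log_le_log (by linarith) (by nlinarith)
  rw [Real.log_mul (by linarith) (by linarith)] at h1
  have h2 : Real.log (1 + a) ≤ a := by
    have := Real.log_le_sub_one_of_pos (by linarith : 0 < 1 + a)
    linarith
  have h3 := half_le_log_two_add hy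
  nlinarith

lemma logDeriv_conj_conj {f : ℂ → ℂ} (z : ℂ) :
    logDeriv (fun w => (starRingEnd ℂ) (f ((starRingEnd ℂ) w))) z =
      (starRingEnd ℂ) (logDeriv f ((starRingEnd ℂ) z)) := by
  rw [logDeriv_apply, logDeriv_apply, map_div₀]
  congr 1
  exact congrFun deriv_conj_conj z

lemma exists_forall_le_abs_sub (R₀ : ℝ) (S : Finset ℝ) :
    ∃ R ∈ Set.Icc R₀ (R₀ + 1), ∀ x ∈ S, 1 / (4 * ((S.card : ℝ) + 1)) ≤ |R - x| := by
  by_contra! hcon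
  set n := S.card with hn
  have hpos : (0 : ℝ) < n + 1 := by positivity
  have hp : ∀ j ∈ Finset.range (n + 1), ∃ x ∈ S,
      |R₀ + j / ((n : ℝ) + 1) - x| < 1 / (4 * ((n : ℝ) + 1)) := by
    intro j hj
    refine hcon _ ⟨by simp; positivity, ?_⟩
    have : (j : ℝ) ≤ n + 1 := by
      exact_mod_cast (Finset.mem_range.mp hj).le
    have := (div_le_one hpos).mpr this
    linarith
  choose! x hxS hx using hp
  obtain ⟨i, hi, j, hj, hij, hxx⟩ := Finset.exists_ne_map_eq_of_card_lt_of_maps_to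
    (s := Finset.range (n + 1)) (t := S) (by simp [hn]) (f := x) hxS
  have h1 := hx i hi
  have h2 := hx j hj
  rw [← hxx] at h2
  have h3 : |((i : ℝ) - j) / (n + 1)| < 1 / (2 * ((n : ℝ) + 1)) := by
    have h4 : ((i : ℝ) - j) / (n + 1) =
        (R₀ + i / ((n : ℝ) + 1) - x i) - (R₀ + j / ((n : ℝ) + 1) - x i) := by ring
    rw [h4]
    refine (abs_sub _ _).trans_lt ((add_lt_add h1 h2).trans_eq ?_)
    field_simp; norm_num
  rw [abs_div, abs_of_pos hpos, div_lt_div_iff₀ hpos (by positivity)] at h3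
  have h5 : (1 : ℝ) ≤ |(i : ℝ) - j| := by
    have : (1 : ℤ) ≤ |(i : ℤ) - j| := Int.one_le_abs (by omega)
    exact_mod_cast this
  nlinarith

namespace TemperedFE

variable {f : ℂ → ℂ} {σ A : ℝ} {ω : ℂ}

lemma exists_ne_zero (h : TemperedFE f σ A ω) : ∃ z, f z ≠ 0 :=
  ⟨A, h.ne_zero _ (by simp)⟩

lemma reflect_eq_zero (h : TemperedFE f σ A ω) {z : ℂ} (hz : f z = 0) :
    f ((σ : ℂ) - (starRingEnd ℂ) z) = 0 := by
  have hω : ω ≠ 0 := by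
    intro h0; have := h.norm_eq_one; simp [h0] at this
  have h1 := h.fe z
  rw [hz] at h1
  simpa [hω] using h1.symm

lemma re_lt (h : TemperedFE f σ A ω) {ρ : ℂ} (hρ : f ρ = 0) : ρ.re < A := by
  by_contra hcon
  exact h.ne_zero ρ (not_lt.mp hcon) hρ

lemma lt_re (h : TemperedFE f σ A ω) {ρ : ℂ} (hρ : f ρ = 0) : σ - A < ρ.re := by
  have h1 := h.re_lt (h.reflect_eq_zero hρ)
  simp at h1
  linarith

lemma abs_re_sub_lt (h : TemperedFE f σ A ω) {ρ : ℂ} (hρ : f ρ = 0) : |ρ.re - σ / 2| < A := by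
  have h1 := h.re_lt hρ
  have h2 := h.lt_re hρ
  have h3 := h.sigma_pos
  rw [abs_lt]; constructor <;> linarith

lemma abs_norm_sub_abs_im_lt (h : TemperedFE f σ A ω) {ρ : ℂ} (hρ : f ρ = 0) :
    ‖ρ - (σ / 2 : ℝ)‖ < |ρ.im| + A ∧ |ρ.im| ≤ ‖ρ - (σ / 2 : ℝ)‖ := by
  have h1 := h.abs_re_sub_lt hρ
  have h2 := Complex.norm_le_abs_re_add_abs_im (ρ - (σ / 2 : ℝ))
  have h3 := Complex.abs_im_le_norm (ρ - (σ / 2 : ℝ))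
  simp only [Complex.sub_re, Complex.sub_im, Complex.ofReal_re, Complex.ofReal_im, sub_zero] at h2 h3
  exact ⟨by linarith, h3⟩

lemma logDeriv_reflect (h : TemperedFE f σ A ω) (z : ℂ) :
    logDeriv f z = -(starRingEnd ℂ) (logDeriv f ((σ : ℂ) - (starRingEnd ℂ) z)) := by
  have hω : ω ≠ 0 := by
    intro h0; have := h.norm_eq_one; simp [h0] at this
  have h1 : f = fun s => ω * (fun w => (starRingEnd ℂ) (f ((starRingEnd ℂ) w))) ((σ : ℂ) - s) := by
    funext s
    rw [h.fe s]
    simp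
  have hd : Differentiable ℂ (fun w => (starRingEnd ℂ) (f ((starRingEnd ℂ) w))) :=
    fun w => differentiableAt_conj_conj_iff.mpr (h.differentiable _)
  conv_lhs => rw [h1]
  rw [logDeriv_const_mul _ _ hω]
  have h2 := logDeriv_comp (f := fun w => (starRingEnd ℂ) (f ((starRingEnd ℂ) w)))
    (g := fun s => (σ : ℂ) - s) (x := z) (hd _) (by fun_prop)
  rw [Function.comp_def] at h2
  rw [h2, logDeriv_conj_conj]
  simp

/-- Zero counting and partial fractions near points of the half plane `A ≤ Re s`. -/
lemma exists_local_bound (h : TemperedFE f σ A ω) {K : ℝ} (hK : 0 < K) :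
    ∃ C : ℝ, 0 < C ∧ ∀ z₀ : ℂ, A ≤ z₀.re → ∀ S : Finset ℂ,
      (∀ ρ, ρ ∈ S ↔ f ρ = 0 ∧ ρ ∈ Metric.closedBall z₀ (2 * K)) →
      (∑ ρ ∈ S, (zeroOrder f ρ : ℝ) ≤ C * Real.log (2 + ‖z₀‖)) ∧
      ∀ z ∈ Metric.closedBall z₀ K, f z ≠ 0 →
        ‖logDeriv f z - ∑ ρ ∈ S, (zeroOrder f ρ : ℂ) / (z - ρ)‖ ≤ C * Real.log (2 + ‖z₀‖) := by
  obtain ⟨k, hk⟩ := h.ratio (8 * K)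
  refine ⟨(k + 1) + 12 * (k + 1) / K, by positivity, fun z₀ hz₀ S hS => ?_⟩
  have hpos := norm_nonneg z₀
  have hM : 1 < (2 + ‖z₀‖) ^ (k + 1) := one_lt_pow₀ (by linarith) (by omega)
  have hloc := local_zeros_and_logDeriv h.differentiable (h.ne_zero z₀ hz₀) hK hM ?_ hS
  · rw [Real.log_pow] at hloc
    push_cast at hloc
    have hl := log_two_add_pos hpos
    have e1 : 0 ≤ ((k : ℝ) + 1) * Real.log (2 + ‖z₀‖) := by positivity
    have e2 : 0 ≤ 12 * ((k : ℝ) + 1) / K * Real.log (2 + ‖z₀‖) := by positivity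
    refine ⟨by linarith [hloc.1], fun z hz hfz => (hloc.2 z hz hfz).trans ?_⟩
    have : 12 * (((k : ℝ) + 1) * Real.log (2 + ‖z₀‖)) / K =
      12 * ((k : ℝ) + 1) / K * Real.log (2 + ‖z₀‖) := by ring
    linarith
  · intro z hz
    refine (hk z₀ z hz₀ (by simpa [dist_eq_norm] using hz)).trans ?_
    gcongr
    · linarith
    · omega

/-- The finset of zeros of `f` in a compact set. -/
def zeros (h : TemperedFE f σ A ω) (K : Set ℂ) (hK : IsCompact K) : Finset ℂ :=
  (finite_zeros_of_isCompact h.differentiable h.exists_ne_zero hK).toFinset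

lemma mem_zeros (h : TemperedFE f σ A ω) {K : Set ℂ} (hK : IsCompact K) {ρ : ℂ} :
    ρ ∈ h.zeros K hK ↔ f ρ = 0 ∧ ρ ∈ K := by
  simp [zeros]

/-- Zero counting in horizontal strips. -/
lemma exists_strip_bound (h : TemperedFE f σ A ω) {W : ℝ} (hW : 0 < W) :
    ∃ C : ℝ, 0 < C ∧ ∀ T : ℝ, 0 ≤ T → ∀ S : Finset ℂ,
      (∀ ρ ∈ S, f ρ = 0 ∧ T ≤ |ρ.im| ∧ |ρ.im| ≤ T + W) →
      ∑ ρ ∈ S, (zeroOrder f ρ : ℝ) ≤ C * Real.log (2 + T) := by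
  classical
  have hA := h.one_le
  obtain ⟨C, hC, hloc⟩ := h.exists_local_bound (K := 2 * A + W) (by linarith)
  refine ⟨2 * (C * (1 + 2 * A)), by positivity, fun T hT S hS => ?_⟩
  have key : ∀ (τ : ℝ) (S' : Finset ℂ), |τ| = T →
      (∀ ρ ∈ S', f ρ = 0 ∧ |ρ.im - τ| ≤ W) →
      ∑ ρ ∈ S', (zeroOrder f ρ : ℝ) ≤ C * (1 + 2 * A) * Real.log (2 + T) := by
    intro τ S' hτ hS'
    set z₀ : ℂ := ⟨A, τ⟩ with hz₀
    have hnorm : ‖z₀‖ ≤ T + A := by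
      refine (Complex.norm_le_abs_re_add_abs_im z₀).trans ?_
      simp only [hz₀, hτ, abs_of_pos (by linarith : 0 < A)]
      linarith
    have h1 := (hloc z₀ le_rfl (h.zeros _ (isCompact_closedBall z₀ (2 * (2 * A + W))))
      fun ρ => h.mem_zeros _).1
    have hsub : S' ⊆ h.zeros _ (isCompact_closedBall z₀ (2 * (2 * A + W))) := by
      intro ρ hρ
      obtain ⟨hρ0, hρW⟩ := hS' ρ hρ
      refine (h.mem_zeros _).mpr ⟨hρ0, ?_⟩
      rw [Metric.mem_closedBall, dist_eq_norm]
      refine (Complex.norm_le_abs_re_add_abs_im _).trans ?_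
      simp only [Complex.sub_re, Complex.sub_im, hz₀]
      have h2 : |ρ.re - A| ≤ 2 * A := by
        have := h.re_lt hρ0
        have := h.lt_re hρ0
        have := h.sigma_pos
        rw [abs_le]; constructor <;> linarith
      linarith
    refine (Finset.sum_le_sum_of_subset_of_nonneg hsub fun _ _ _ => by positivity).trans
      (h1.trans ?_)
    rw [mul_assoc]
    gcongr
    exact log_two_add_le (by linarith) (norm_nonneg _) hT hnorm
  have hsplit := Finset.sum_filter_add_sum_filter_not S (fun ρ : ℂ => 0 ≤ ρ.im)
    (fun ρ => (zeroOrder f ρ : ℝ))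
  have hp := key T (S.filter fun ρ : ℂ => 0 ≤ ρ.im) (abs_of_nonneg hT) (by
    intro ρ hρ
    obtain ⟨hρ, him⟩ := Finset.mem_filter.mp hρ
    obtain ⟨h0, h1, h2⟩ := hS ρ hρ
    rw [abs_of_nonneg him] at h1 h2
    exact ⟨h0, by rw [abs_le]; constructor <;> linarith⟩)
  have hn := key (-T) (S.filter fun ρ : ℂ => ¬ 0 ≤ ρ.im) (by rw [abs_neg, abs_of_nonneg hT]) (by
    intro ρ hρ
    obtain ⟨hρ, him⟩ := Finset.mem_filter.mp hρ
    obtain ⟨h0, h1, h2⟩ := hS ρ hρ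
    rw [abs_of_neg (not_le.mp him)] at h1 h2
    exact ⟨h0, by rw [abs_le]; constructor <;> linarith⟩)
  rw [← hsplit]
  linarith

end TemperedFE

namespace TemperedFE

variable {f : ℂ → ℂ} {σ A : ℝ} {ω : ℂ}

lemma norm_reflect_sub (σ : ℝ) (z : ℂ) :
    ‖((σ : ℂ) - (starRingEnd ℂ) z) - (σ / 2 : ℝ)‖ = ‖z - (σ / 2 : ℝ)‖ := by
  rw [← Complex.norm_conj (z - (σ / 2 : ℝ)), ← norm_neg]
  congr 1
  simp only [map_sub, Complex.conj_ofReal]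
  push_cast
  ring

/-- Circles avoiding the zeros, on which the logarithmic derivative is small. -/
lemma exists_good_radius (h : TemperedFE f σ A ω) :
    ∃ C : ℝ, 0 < C ∧ ∀ R₀ : ℝ, A + 1 ≤ R₀ → ∃ R ∈ Set.Icc R₀ (R₀ + 1),
      ∀ z : ℂ, ‖z - (σ / 2 : ℝ)‖ = R → f z ≠ 0 ∧ ‖logDeriv f z‖ ≤ C * Real.log (2 + R) ^ 2 := by
  classical
  have hA := h.one_le
  have hσ := h.sigma_pos
  obtain ⟨C₁, hC₁, hstrip⟩ := h.exists_strip_bound (W := A + 3) (by linarith)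
  obtain ⟨C₂, hC₂, hloc⟩ := h.exists_local_bound (K := A) (by linarith)
  set B : ℝ := 1 + 2 * (2 * A) with hB
  refine ⟨C₂ * B * (4 * (C₁ + 2)) + 2 * (C₂ * B), by positivity, fun R₀ hR₀ => ?_⟩
  set c : ℂ := ((σ / 2 : ℝ) : ℂ) with hc
  set S := (h.zeros _ (isCompact_closedBall c (R₀ + 2))).filter fun ρ => R₀ - 1 ≤ ‖ρ - c‖ with hS
  obtain ⟨R, hR, hRS⟩ := exists_forall_le_abs_sub R₀ (S.image fun ρ => ‖ρ - c‖)
  set n := (S.image fun ρ : ℂ => ‖ρ - c‖).card with hn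
  have hRpos : 0 < R := by linarith [hR.1]
  have hl : 1 / 2 ≤ Real.log (2 + R) := half_le_log_two_add hRpos.le
  have hncard : (n : ℝ) ≤ C₁ * Real.log (2 + R) := by
    have h1 : (n : ℝ) ≤ ∑ ρ ∈ S, (zeroOrder f ρ : ℝ) := by
      have h2 : (n : ℝ) ≤ S.card := by exact_mod_cast Finset.card_image_le
      refine h2.trans ?_
      rw [Finset.card_eq_sum_ones]
      push_cast
      refine Finset.sum_le_sum fun ρ hρ => ?_
      have := zeroOrder_pos h.differentiable h.exists_ne_zero
        ((h.mem_zeros _).mp (Finset.mem_filter.mp hρ).1).1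
      exact_mod_cast this
    refine h1.trans ((hstrip (R₀ - 1 - A) (by linarith) S fun ρ hρ => ?_).trans ?_)
    · obtain ⟨hρ1, hρ2⟩ := Finset.mem_filter.mp hρ
      obtain ⟨hρ0, hρ3⟩ := (h.mem_zeros _).mp hρ1
      rw [Metric.mem_closedBall, dist_eq_norm] at hρ3
      have := h.abs_norm_sub_abs_im_lt hρ0
      exact ⟨hρ0, by linarith, by linarith⟩
    · gcongr
      · linarith
      · linarith [hR.1]
  set η : ℝ := 1 / (4 * ((n : ℝ) + 1)) with hη
  have hηpos : 0 < η := by positivity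
  have hη1 : η ≤ 1 := by
    rw [hη, div_le_one (by positivity)]
    linarith [(Nat.cast_nonneg n : (0 : ℝ) ≤ n)]
  have hgap : ∀ ρ, f ρ = 0 → η ≤ |R - ‖ρ - c‖| := by
    intro ρ hρ
    by_cases h1 : R₀ - 1 ≤ ‖ρ - c‖
    · by_cases h2 : ‖ρ - c‖ ≤ R₀ + 2
      · refine hRS _ (Finset.mem_image_of_mem _ (Finset.mem_filter.mpr ⟨(h.mem_zeros _).mpr
          ⟨hρ, ?_⟩, h1⟩))
        rwa [Metric.mem_closedBall, dist_eq_norm]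
      · rw [abs_sub_comm]
        exact hη1.trans ((by linarith [hR.2] : (1 : ℝ) ≤ ‖ρ - c‖ - R).trans (le_abs_self _))
    · exact hη1.trans ((by linarith [hR.1] : (1 : ℝ) ≤ R - ‖ρ - c‖).trans (le_abs_self _))
  refine ⟨R, hR, ?_⟩
  have hne : ∀ z : ℂ, ‖z - c‖ = R → f z ≠ 0 := by
    intro z hz h0
    have := hgap z h0
    rw [hz, sub_self, abs_zero] at this
    linarith
  have hright : ∀ z : ℂ, ‖z - c‖ = R → σ / 2 ≤ z.re →
      ‖logDeriv f z‖ ≤ (C₂ * B * (4 * (C₁ + 2)) + 2 * (C₂ * B)) * Real.log (2 + R) ^ 2 := by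
    intro z hz hzre
    have hz₀ : A ≤ (z + A).re := by simp; linarith
    have hzn : ‖z + A‖ ≤ R + 2 * A := by
      calc ‖z + A‖ = ‖(z - c) + (c + A)‖ := by ring_nf
        _ ≤ ‖z - c‖ + (‖c‖ + ‖(A : ℂ)‖) := (norm_add_le _ _).trans (by gcongr; exact norm_add_le _ _)
        _ ≤ R + 2 * A := by
          rw [hz, hc, Complex.norm_of_nonneg (by linarith), Complex.norm_of_nonneg (by linarith)]
          linarith [h.sigma_le]
    have hlog : Real.log (2 + ‖z + A‖) ≤ B * Real.log (2 + R) :=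
      log_two_add_le (by linarith) (norm_nonneg _) hRpos.le hzn
    obtain ⟨hcount, hpf⟩ := hloc (z + A) hz₀ _ fun ρ =>
      h.mem_zeros (isCompact_closedBall (z + A) (2 * A))
    have h1 := hpf z (by
      rw [Metric.mem_closedBall, dist_eq_norm]
      simp [abs_of_pos (by linarith : 0 < A)]) (hne z hz)
    set S' := h.zeros _ (isCompact_closedBall (z + A) (2 * A)) with hS'
    have h2 : ‖∑ ρ ∈ S', (zeroOrder f ρ : ℂ) / (z - ρ)‖ ≤
        (C₂ * (B * Real.log (2 + R))) * (4 * ((n : ℝ) + 1)) := by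
      refine (norm_sum_le _ _).trans ?_
      refine le_trans ?_ (mul_le_mul_of_nonneg_right (hcount.trans
        (mul_le_mul_of_nonneg_left hlog hC₂.le)) (by positivity))
      rw [Finset.sum_mul]
      refine Finset.sum_le_sum fun ρ hρ => ?_
      rw [norm_div, Complex.norm_natCast, div_eq_mul_inv]
      gcongr
      have h3 : η ≤ ‖z - ρ‖ := by
        refine (hgap ρ ((h.mem_zeros _).mp hρ).1).trans ?_
        rw [← hz]
        have := abs_norm_sub_norm_le (z - c) (ρ - c)
        simpa using this
      rw [inv_le_comm₀ (hηpos.trans_le h3) (by positivity), ← one_div]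
      exact h3
    have h4 : ‖logDeriv f z‖ ≤ C₂ * (B * Real.log (2 + R)) +
        (C₂ * (B * Real.log (2 + R))) * (4 * ((n : ℝ) + 1)) := by
      have h5 := norm_add_le (logDeriv f z - ∑ ρ ∈ S', (zeroOrder f ρ : ℂ) / (z - ρ))
        (∑ ρ ∈ S', (zeroOrder f ρ : ℂ) / (z - ρ))
      rw [sub_add_cancel] at h5
      have h6 : C₂ * Real.log (2 + ‖z + A‖) ≤ C₂ * (B * Real.log (2 + R)) := by gcongr
      linarith
    have h7 : (n : ℝ) + 1 ≤ (C₁ + 2) * Real.log (2 + R) := by linarith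
    have hBpos : 0 < B := by positivity
    have h8 : (C₂ * (B * Real.log (2 + R))) * (4 * ((n : ℝ) + 1)) ≤
        (C₂ * (B * Real.log (2 + R))) * (4 * ((C₁ + 2) * Real.log (2 + R))) := by gcongr
    have h9 : C₂ * B * Real.log (2 + R) * 1 ≤
        C₂ * B * Real.log (2 + R) * (2 * Real.log (2 + R)) := by
      gcongr; linarith
    linarith
  intro z hz
  refine ⟨hne z hz, ?_⟩
  by_cases hzre : σ / 2 ≤ z.re
  · exact hright z hz hzre
  · rw [h.logDeriv_reflect z, norm_neg, Complex.norm_conj]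
    refine hright _ ((norm_reflect_sub σ z).trans hz) ?_
    simp
    linarith

/-- Far to the right, the logarithmic derivatives at conjugate points are nearly conjugate. -/
lemma exists_logDeriv_sub_conj_bound (h : TemperedFE f σ A ω) :
    ∃ C : ℝ, 0 < C ∧ ∀ z : ℂ, A < z.re →
      ‖logDeriv f z - (starRingEnd ℂ) (logDeriv f ((starRingEnd ℂ) z))‖ ≤
        C * Real.log (2 + ‖z‖) / (z.re - A) := by
  have hA := h.one_le
  obtain ⟨k, hk⟩ := h.conj_ratio
  refine ⟨24 * (3 * k + 1), by positivity, fun z₀ hz₀ => ?_⟩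
  set fc : ℂ → ℂ := fun w => (starRingEnd ℂ) (f ((starRingEnd ℂ) w)) with hfc
  have hdc : Differentiable ℂ fc :=
    fun w => differentiableAt_conj_conj_iff.mpr (h.differentiable _)
  have hfc0 : ∀ z : ℂ, A ≤ z.re → fc z ≠ 0 := by
    intro z hz
    simpa [hfc] using h.ne_zero ((starRingEnd ℂ) z) (by simpa using hz)
  have hball : ∀ w ∈ Metric.ball z₀ (z₀.re - A), A ≤ w.re := by
    intro w hw
    rw [Metric.mem_ball, dist_eq_norm] at hw
    have := (abs_le.mp (Complex.abs_re_le_norm (w - z₀))).1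
    simp at this
    linarith
  have hn0 := norm_nonneg z₀
  have hM : 1 < (2 + ‖z₀‖) ^ (3 * k + 1) := one_lt_pow₀ (by linarith) (by omega)
  have hb := norm_logDeriv_le_of_ball (g := fun w => f w / fc w) (z₀ := z₀) (R := z₀.re - A)
    (M := (2 + ‖z₀‖) ^ (3 * k + 1)) (z := z₀) (by linarith) hM
    (fun w hw => ((h.differentiable w).div (hdc w) (hfc0 w (hball w hw))).differentiableWithinAt)
    (fun w hw => div_ne_zero (h.ne_zero w (hball w hw)) (hfc0 w (hball w hw)))
    ?_ (Metric.mem_closedBall_self (by linarith))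
  · rw [logDeriv_div z₀ (h.ne_zero _ hz₀.le) (hfc0 _ hz₀.le) (h.differentiable _) (hdc _), hfc,
      logDeriv_conj_conj, Real.log_pow] at hb
    refine hb.trans (le_of_eq ?_)
    push_cast
    ring
  · intro w hw
    have hwre := hball w hw
    have h1 : ‖f w / fc w‖ ≤ (2 + ‖w‖) ^ k := by
      rw [norm_div, hfc, Complex.norm_conj, div_le_iff₀]
      · exact hk w hwre
      · have := hfc0 w hwre
        rw [hfc] at this
        simpa using this
    have h2 : 1 ≤ (2 + ‖z₀‖) ^ k * ‖f z₀ / fc z₀‖ := by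
      have h3 := hk ((starRingEnd ℂ) z₀) (by simpa using hz₀.le)
      rw [Complex.norm_conj, Complex.conj_conj] at h3
      rw [norm_div, hfc, Complex.norm_conj, ← mul_div_assoc, one_le_div]
      · exact h3
      · have := hfc0 z₀ hz₀.le
        rw [hfc] at this
        simpa using this
    have h4 : ‖w‖ ≤ 2 * ‖z₀‖ := by
      rw [Metric.mem_ball, dist_eq_norm] at hw
      have h5 := norm_add_le (w - z₀) z₀
      rw [sub_add_cancel] at h5
      have := (abs_le.mp (Complex.abs_re_le_norm z₀)).2
      linarith
    have h6 : (2 + ‖w‖) ^ k ≤ (2 + ‖z₀‖) ^ (2 * k) := by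
      rw [pow_mul]
      gcongr
      nlinarith
    calc ‖f w / fc w‖ ≤ (2 + ‖z₀‖) ^ (2 * k) * 1 := by rw [mul_one]; exact h1.trans h6
      _ ≤ (2 + ‖z₀‖) ^ (2 * k) * ((2 + ‖z₀‖) ^ k * ‖f z₀ / fc z₀‖) := by gcongr
      _ = (2 + ‖z₀‖) ^ (3 * k) * ‖f z₀ / fc z₀‖ := by rw [← mul_assoc, ← pow_add]; ring_nf
      _ ≤ (2 + ‖z₀‖) ^ (3 * k + 1) * ‖f z₀ / fc z₀‖ := by
        gcongr
        · linarith
        · omega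

end TemperedFE

lemma circleIntegral_sub_inv_mul_sub_inv_eq_zero {c s ρ : ℂ} {R : ℝ} (hs : s ∈ Metric.ball c R)
    (hρ : ρ ∈ Metric.ball c R) (hne : s ≠ ρ) :
    (∮ z in C(c, R), (z - s)⁻¹ * (z - ρ)⁻¹) = 0 := by
  have hR : 0 < R := dist_nonneg.trans_lt hs
  have hci : ∀ w ∈ Metric.ball c R, CircleIntegrable (fun z => (z - w)⁻¹) c R := by
    intro w hw
    rw [circleIntegrable_sub_inv_iff]
    right
    rw [Metric.mem_sphere, abs_of_pos hR]
    exact (Metric.mem_ball.mp hw).ne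
  have h1 : (∮ z in C(c, R), (z - s)⁻¹ * (z - ρ)⁻¹) =
      ∮ z in C(c, R), (s - ρ)⁻¹ * ((z - s)⁻¹ - (z - ρ)⁻¹) := by
    refine circleIntegral.integral_congr hR.le fun z hz => ?_
    have hzs : z - s ≠ 0 := sub_ne_zero.mpr fun h =>
      (Metric.mem_ball.mp hs).ne (h ▸ Metric.mem_sphere.mp hz)
    have hzρ : z - ρ ≠ 0 := sub_ne_zero.mpr fun h =>
      (Metric.mem_ball.mp hρ).ne (h ▸ Metric.mem_sphere.mp hz)
    have hsρ : s - ρ ≠ 0 := sub_ne_zero.mpr hne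
    field_simp
    ring
  rw [h1, circleIntegral.integral_const_mul, circleIntegral.integral_sub (hci s hs) (hci ρ hρ),
    circleIntegral.integral_sub_inv_of_mem_ball hs, circleIntegral.integral_sub_inv_of_mem_ball hρ,
    sub_self, mul_zero]

lemma continuousOn_logDeriv {f : ℂ → ℂ} (hf : Differentiable ℂ f) {K : Set ℂ}
    (hK : ∀ z ∈ K, f z ≠ 0) : ContinuousOn (logDeriv f) K := by
  have hd : Continuous (deriv f) := (hf.contDiff (n := 1)).continuous_deriv le_rfl
  exact hd.continuousOn.div hf.continuous.continuousOn hK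

/-- The residue theorem for `f' / f` against the Cauchy kernel. -/
lemma circleIntegral_sub_inv_mul_logDeriv {f : ℂ → ℂ} (hf : Differentiable ℂ f) {c s : ℂ} {R : ℝ}
    (hs : s ∈ Metric.ball c R) (hfs : f s ≠ 0) (hR : ∀ z ∈ Metric.sphere c R, f z ≠ 0)
    {S : Finset ℂ} (hS : ∀ ρ, ρ ∈ S ↔ f ρ = 0 ∧ ρ ∈ Metric.closedBall c R) :
    (∮ z in C(c, R), (z - s)⁻¹ * logDeriv f z) =
      2 * π * I * (logDeriv f s - ∑ ρ ∈ S, (zeroOrder f ρ : ℂ) / (s - ρ)) := by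
  have hRpos : 0 < R := dist_nonneg.trans_lt hs
  obtain ⟨g, hg, hfg, hgS⟩ := exists_eq_prod_mul hf ⟨s, hfs⟩ S
  have hSball : ∀ ρ ∈ S, ρ ∈ Metric.ball c R := by
    intro ρ hρ
    obtain ⟨h0, h1⟩ := (hS ρ).mp hρ
    exact lt_of_le_of_ne h1 fun h => hR ρ h h0
  have hg0 : ∀ z ∈ Metric.closedBall c R, g z ≠ 0 := by
    intro z hz hgz
    exact hgS z ((hS z).mpr ⟨by rw [hfg, hgz, mul_zero], hz⟩) hgz
  have hdiff : Differentiable ℂ (deriv g) := (hg.contDiff (n := 2)).differentiable_deriv_two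
  have hcauchy : (∮ z in C(c, R), (z - s)⁻¹ * logDeriv g z) = 2 * π * I * logDeriv g s := by
    have := circleIntegral_sub_inv_smul_of_differentiable_on_off_countable (R := R) (c := c)
      (w := s) (f := logDeriv g) Set.countable_empty hs (continuousOn_logDeriv hg hg0)
      fun x hx => (hdiff x).div (hg x) (hg0 x (Metric.ball_subset_closedBall hx.1))
    simpa [smul_eq_mul] using this
  have hinv : ∀ w ∈ Metric.ball c R, ContinuousOn (fun z => (z - w)⁻¹) (Metric.sphere c R) := by
    intro w hw
    refine ContinuousOn.inv₀ (by fun_prop) fun z hz => sub_ne_zero.mpr fun h => ?_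
    exact (Metric.mem_ball.mp hw).ne (h ▸ Metric.mem_sphere.mp hz)
  have hsplit : (∮ z in C(c, R), (z - s)⁻¹ * logDeriv f z) =
      ∮ z in C(c, R), (∑ ρ ∈ S, (zeroOrder f ρ : ℂ) * ((z - s)⁻¹ * (z - ρ)⁻¹)) +
        (z - s)⁻¹ * logDeriv g z := by
    refine circleIntegral.integral_congr hRpos.le fun z hz => ?_
    rw [logDeriv_eq_sum_add hg hfg (hR z hz) fun ρ hρ h => hR z hz (h ▸ ((hS ρ).mp hρ).1),
      mul_add, Finset.mul_sum]
    congr 1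
    refine Finset.sum_congr rfl fun ρ _ => ?_
    rw [div_eq_mul_inv]; ring
  have hterm : ∀ ρ ∈ S, CircleIntegrable
      (fun z => (zeroOrder f ρ : ℂ) * ((z - s)⁻¹ * (z - ρ)⁻¹)) c R := by
    intro ρ hρ
    refine ContinuousOn.circleIntegrable hRpos.le ?_
    exact continuousOn_const.mul ((hinv s hs).mul (hinv ρ (hSball ρ hρ)))
  rw [hsplit, circleIntegral.integral_add, hcauchy, circleIntegral.integral_fun_sum hterm,
    Finset.sum_eq_zero, zero_add,
    logDeriv_eq_sum_add hg hfg hfs fun ρ hρ h => hfs (h ▸ ((hS ρ).mp hρ).1), add_sub_cancel_left]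
  · intro ρ hρ
    rw [circleIntegral.integral_const_mul, circleIntegral_sub_inv_mul_sub_inv_eq_zero hs
      (hSball ρ hρ) (fun h => hfs (h ▸ ((hS ρ).mp hρ).1)), mul_zero]
  · exact ContinuousOn.circleIntegrable hRpos.le (continuousOn_finsetSum _ fun ρ hρ =>
      continuousOn_const.mul ((hinv s hs).mul (hinv ρ (hSball ρ hρ))))
  · exact ContinuousOn.circleIntegrable hRpos.le ((hinv s hs).mul
      ((continuousOn_logDeriv hg hg0).mono Metric.sphere_subset_closedBall))

lemma two_mul_div_pi_le_cos {θ δ : ℝ} (h : |θ| ≤ π / 2 - δ) : δ / 2 ≤ Real.cos θ ∨ δ < 0 := by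
  by_cases hδ : δ < 0
  · exact Or.inr hδ
  left
  rw [← Real.cos_abs]
  have h1 := Real.one_sub_mul_le_cos (abs_nonneg θ) (by linarith)
  have h2 : 2 / π * |θ| ≤ 2 / π * (π / 2 - δ) := by gcongr
  have h3 : 2 / π * (π / 2 - δ) = 1 - 2 / π * δ := by
    field_simp
  have h4 : 1 / 2 ≤ 2 / π := by
    rw [div_le_div_iff₀ (by norm_num) Real.pi_pos]; linarith [Real.pi_le_four]
  have h5 : 1 / 2 * δ ≤ 2 / π * δ := by
    have := not_lt.mp hδ
    gcongr
  linarith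

namespace TemperedFE

variable {f : ℂ → ℂ} {σ A : ℝ} {ω : ℂ}

/-- The mean of the logarithmic derivative over a large circle avoiding the zeros is small. -/
lemma exists_circle_mean_bound (h : TemperedFE f σ A ω) :
    ∃ C : ℝ, 0 < C ∧ ∀ R B δ : ℝ, 0 < δ → δ ≤ π / 2 → 4 * A ≤ R * δ → 0 < R →
      (∀ z : ℂ, ‖z - (σ / 2 : ℝ)‖ = R → f z ≠ 0 ∧ ‖logDeriv f z‖ ≤ B) →
      ‖∫ θ in 0..2 * π, logDeriv f (circleMap ((σ / 2 : ℝ) : ℂ) R θ)‖ ≤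
        C * Real.log (2 + R) / (R * δ) + 4 * B * δ := by
  obtain ⟨C, hC, hE⟩ := h.exists_logDeriv_sub_conj_bound
  have hA := h.one_le
  have hσ := h.sigma_pos
  refine ⟨4 * (C * (1 + 2 * A)) * π, by positivity, fun R B δ hδ hδ2 hRδ hR hB => ?_⟩
  set c : ℂ := ((σ / 2 : ℝ) : ℂ) with hc
  set g : ℝ → ℂ := fun θ => logDeriv f (circleMap c R θ) with hg
  have hcirc : ∀ θ : ℝ, ‖circleMap c R θ - c‖ = R := by
    intro θ; simp [circleMap, abs_of_pos hR]
  have hgB : ∀ θ, ‖g θ‖ ≤ B := fun θ => (hB _ (hcirc θ)).2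
  have hcont : Continuous g := by
    refine (continuousOn_logDeriv h.differentiable (K := Metric.sphere c R) fun z hz =>
      (hB z (by rwa [← dist_eq_norm])).1).comp_continuous (continuous_circleMap c R) fun θ => ?_
    rw [Metric.mem_sphere, dist_eq_norm, hcirc]
  have hper : Function.Periodic g (2 * π) := fun θ => by
    simp only [hg, periodic_circleMap c R θ]
  have hconj : ∀ θ : ℝ, (starRingEnd ℂ) (circleMap c R θ) = circleMap c R (-θ) := by
    intro θ
    simp [circleMap, hc, ← Complex.exp_conj, -Complex.ofReal_div]
  have hrefl : ∀ θ : ℝ, g (θ + π) = -(starRingEnd ℂ) (g (-θ)) := by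
    intro θ
    simp only [hg]
    rw [h.logDeriv_reflect, hconj]
    congr 3
    simp only [circleMap, hc]
    push_cast
    rw [show (-((θ : ℂ) + π)) * I = -(θ : ℂ) * I - π * I by ring, Complex.exp_sub,
      Complex.exp_pi_mul_I]
    ring
  set E : ℝ → ℂ := fun θ => g θ + g (θ + π) with hEdef
  have hcont' : Continuous fun θ => g (θ + π) := hcont.comp (by fun_prop)
  have hEcont : Continuous E := hcont.add hcont'
  have htotal : (∫ θ in 0..2 * π, g θ) = ∫ θ in -(π / 2)..π / 2, E θ := by
    have h1 := hper.intervalIntegral_add_eq 0 (-(π / 2))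
    rw [zero_add] at h1
    rw [h1, ← intervalIntegral.integral_add_adjacent_intervals
      (hcont.intervalIntegrable (-(π / 2)) (π / 2))
      (hcont.intervalIntegrable (π / 2) (-(π / 2) + 2 * π)),
      hEdef, intervalIntegral.integral_add (hcont.intervalIntegrable _ _)
      (hcont'.intervalIntegrable _ _), intervalIntegral.integral_comp_add_right]
    congr 2 <;> ring
  have hE2 : ∀ θ, ‖E θ‖ ≤ 2 * B := fun θ => by
    linarith [norm_add_le (g θ) (g (θ + π)), hgB θ, hgB (θ + π)]
  have hEsmall : ∀ θ : ℝ, |θ| ≤ π / 2 - δ →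
      ‖E θ‖ ≤ 4 * (C * (1 + 2 * A)) * Real.log (2 + R) / (R * δ) := by
    intro θ hθ
    have hcos : δ / 2 ≤ Real.cos θ := (two_mul_div_pi_le_cos hθ).resolve_right (by linarith)
    have hre : (circleMap c R θ).re = σ / 2 + R * Real.cos θ := by
      simp [circleMap, hc, Complex.exp_re]
    have hlow : R * δ / 4 ≤ (circleMap c R θ).re - A := by
      rw [hre]
      have : R * (δ / 2) ≤ R * Real.cos θ := by gcongr
      linarith
    have hRδpos : 0 < R * δ := by positivity
    have h1 := hE (circleMap c R θ) (by linarith)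
    have h2 : E θ = logDeriv f (circleMap c R θ) -
        (starRingEnd ℂ) (logDeriv f ((starRingEnd ℂ) (circleMap c R θ))) := by
      simp only [hEdef, hrefl, hconj]
      simp only [hg, sub_eq_add_neg]
    rw [h2]
    refine h1.trans ?_
    have hn : ‖circleMap c R θ‖ ≤ R + A := by
      have h3 := norm_add_le (circleMap c R θ - c) c
      rw [sub_add_cancel, hcirc, hc, Complex.norm_of_nonneg (by linarith)] at h3
      linarith [h.sigma_le]
    have hlog := log_two_add_le (by linarith) (norm_nonneg _) hR.le hn
    have hlp := log_two_add_pos hR.le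
    rw [show 4 * (C * (1 + 2 * A)) * Real.log (2 + R) / (R * δ) =
      C * ((1 + 2 * A) * Real.log (2 + R)) / (R * δ / 4) by field_simp]
    gcongr
  set D : ℝ := 4 * (C * (1 + 2 * A)) * Real.log (2 + R) / (R * δ) with hD
  have hDpos : 0 ≤ D := by
    have hlp := log_two_add_pos hR.le
    positivity
  rw [htotal, ← intervalIntegral.integral_add_adjacent_intervals
    (hEcont.intervalIntegrable (-(π / 2)) (-(π / 2) + δ))
    (hEcont.intervalIntegrable (-(π / 2) + δ) (π / 2)),
    ← intervalIntegral.integral_add_adjacent_intervals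
    (hEcont.intervalIntegrable (-(π / 2) + δ) (π / 2 - δ))
    (hEcont.intervalIntegrable (π / 2 - δ) (π / 2))]
  have i1 : ‖∫ θ in -(π / 2)..-(π / 2) + δ, E θ‖ ≤ 2 * B * δ := by
    refine (intervalIntegral.norm_integral_le_of_norm_le_const fun θ _ => hE2 θ).trans_eq ?_
    rw [show -(π / 2) + δ - -(π / 2) = δ by ring, abs_of_pos hδ]
  have i3 : ‖∫ θ in π / 2 - δ..π / 2, E θ‖ ≤ 2 * B * δ := by
    refine (intervalIntegral.norm_integral_le_of_norm_le_const fun θ _ => hE2 θ).trans_eq ?_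
    rw [show π / 2 - (π / 2 - δ) = δ by ring, abs_of_pos hδ]
  have i2 : ‖∫ θ in -(π / 2) + δ..π / 2 - δ, E θ‖ ≤ D * π := by
    have hle : -(π / 2) + δ ≤ π / 2 - δ := by linarith
    refine (intervalIntegral.norm_integral_le_of_norm_le_const (C := D) fun θ hθ => ?_).trans ?_
    · rw [Set.uIoc_of_le hle] at hθ
      exact hEsmall θ (by rw [abs_le]; constructor <;> linarith [hθ.1, hθ.2])
    · rw [abs_of_nonneg (by linarith)]
      gcongr
      linarith
  have e : 4 * (C * (1 + 2 * A)) * π * Real.log (2 + R) / (R * δ) = D * π := by rw [hD]; ring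
  rw [e]
  refine (norm_add_le _ _).trans ?_
  have := norm_add_le (∫ θ in -(π / 2) + δ..π / 2 - δ, E θ) (∫ θ in π / 2 - δ..π / 2, E θ)
  linarith

end TemperedFE

lemma tendsto_log_two_add_sq_div_sqrt :
    Tendsto (fun R : ℝ => Real.log (2 + R) ^ 2 / √R) atTop (𝓝 0) := by
  have h1 : Tendsto (fun x : ℝ => Real.log x ^ 2 / x ^ (1 / 2 : ℝ)) atTop (𝓝 0) :=
    (isLittleO_log_rpow_rpow_atTop (s := 1 / 2) 2 (by norm_num)).tendsto_div_nhds_zero.congr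
      fun x => by norm_num
  have h2 := (h1.comp (tendsto_atTop_add_const_left atTop (2 : ℝ) tendsto_id)).mul_const 2
  rw [zero_mul] at h2
  refine squeeze_zero' (Eventually.of_forall fun R => by positivity) ?_ h2
  filter_upwards [eventually_ge_atTop 1] with R hR
  simp only [Function.comp, id, ← Real.sqrt_eq_rpow]
  rw [div_mul_eq_mul_div, div_le_div_iff₀ (by positivity) (by positivity), mul_assoc]
  refine mul_le_mul_of_nonneg_left ?_ (by positivity)
  rw [Real.sqrt_le_left (by positivity), mul_pow, Real.sq_sqrt (by linarith)]
  linarith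

namespace TemperedFE

variable {f : ℂ → ℂ} {σ A : ℝ} {ω : ℂ}

/-- Partial fractions of the logarithmic derivative over discs of suitable radii. -/
lemma exists_disc_approx (h : TemperedFE f σ A ω) {s : ℂ} (hs : f s ≠ 0) :
    ∃ D R₁ : ℝ, 0 < D ∧ A + 1 ≤ R₁ ∧ ∀ R₀ : ℝ, R₁ ≤ R₀ → ∃ R ∈ Set.Icc R₀ (R₀ + 1),
      ‖logDeriv f s - ∑ ρ ∈ h.zeros _ (isCompact_closedBall ((σ / 2 : ℝ) : ℂ) R),
        (zeroOrder f ρ : ℂ) / (s - ρ)‖ ≤ D * (Real.log (2 + R) ^ 2 / √R) := by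
  have hA := h.one_le
  obtain ⟨C₁, hC₁, hgood⟩ := h.exists_good_radius
  obtain ⟨C₂, hC₂, hmean⟩ := h.exists_circle_mean_bound
  set c : ℂ := ((σ / 2 : ℝ) : ℂ) with hc
  refine ⟨2 * C₂ + 4 * C₁ + 2 * ‖s - c‖ * C₁, 16 * A ^ 2 + A + 2 * ‖s - c‖ + 1, by positivity,
    by nlinarith [norm_nonneg (s - c)], fun R₀ hR₀ => ?_⟩
  have hsc := norm_nonneg (s - c)
  obtain ⟨R, hR, hcirc⟩ := hgood R₀ (by nlinarith)
  refine ⟨R, hR, ?_⟩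
  have hR16 : 16 * A ^ 2 ≤ R := by linarith [hR.1]
  have hRpos : 0 < R := by nlinarith
  have hR1 : 1 ≤ R := by nlinarith
  have hRs : 2 * ‖s - c‖ < R := by nlinarith [hR.1]
  set ℓ := Real.log (2 + R) with hℓ
  have hℓ2 : 1 / 2 ≤ ℓ := half_le_log_two_add hRpos.le
  have hsq : 0 < √R := Real.sqrt_pos.mpr hRpos
  have hsqR : √R * √R = R := Real.mul_self_sqrt hRpos.le
  have hsq1 : 1 ≤ √R := Real.one_le_sqrt.mpr hR1
  set δ := 1 / √R with hδ
  have hRδ : R * δ = √R := by rw [hδ, mul_one_div, div_eq_iff hsq.ne', hsqR]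
  have hsqA : 4 * A ≤ √R := Real.le_sqrt_of_sq_le (by nlinarith)
  have hm := hmean R (C₁ * ℓ ^ 2) δ (by positivity) (by
    have h1 : δ ≤ 1 := by rw [hδ, div_le_one hsq]; exact hsq1
    linarith [Real.two_le_pi]) (by rw [hRδ]; exact hsqA) hRpos hcirc
  rw [hRδ] at hm
  have hsball : s ∈ Metric.ball c R := by
    rw [Metric.mem_ball, dist_eq_norm]; linarith
  have hcball : c ∈ Metric.ball c R := Metric.mem_ball_self hRpos
  have hsphere : ∀ z ∈ Metric.sphere c R, ‖z - c‖ = R := fun z hz => by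
    rwa [← dist_eq_norm]
  have hres := circleIntegral_sub_inv_mul_logDeriv h.differentiable hsball hs
    (fun z hz => (hcirc z (hsphere z hz)).1) fun ρ => h.mem_zeros (isCompact_closedBall c R)
  have hcenter : (∮ z in C(c, R), (z - c)⁻¹ * logDeriv f z) =
      I * ∫ θ in 0..2 * π, logDeriv f (circleMap c R θ) := by
    have h1 := Real.circleAverage_eq_circleIntegral (c := c) (f := logDeriv f) hRpos.ne'
    rw [Real.circleAverage_def] at h1
    simp only [smul_eq_mul, Complex.real_smul] at h1
    have hpi : (π : ℂ) ≠ 0 := by exact_mod_cast Real.pi_ne_zero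
    rw [eq_inv_mul_iff_mul_eq₀ (by simp [hpi])] at h1
    rw [← h1]
    push_cast
    field_simp
  have hLcont := continuousOn_logDeriv h.differentiable (K := Metric.sphere c R)
    fun z hz => (hcirc z (hsphere z hz)).1
  have hinv : ∀ w ∈ Metric.ball c R, ContinuousOn (fun z => (z - w)⁻¹) (Metric.sphere c R) := by
    intro w hw
    refine ContinuousOn.inv₀ (by fun_prop) fun z hz => sub_ne_zero.mpr fun h => ?_
    exact (Metric.mem_ball.mp hw).ne (h ▸ Metric.mem_sphere.mp hz)
  have hdiff : ‖(∮ z in C(c, R), (z - s)⁻¹ * logDeriv f z) -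
      ∮ z in C(c, R), (z - c)⁻¹ * logDeriv f z‖ ≤ 2 * π * (2 * ‖s - c‖ * C₁ * (ℓ ^ 2 / R)) := by
    have hi : ∀ w ∈ Metric.ball c R,
        CircleIntegrable (fun z => (z - w)⁻¹ * logDeriv f z) c R := fun w hw =>
      ((hinv w hw).mul hLcont).circleIntegrable hRpos.le
    rw [← circleIntegral.integral_sub (hi s hsball) (hi c hcball)]
    refine (circleIntegral.norm_integral_le_of_norm_le_const hRpos.le
      (C := 2 * ‖s - c‖ * (C₁ * ℓ ^ 2) / (R * R)) fun z hz => ?_).trans_eq (by field_simp)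
    have hz' := hsphere z hz
    have hzs : R / 2 ≤ ‖z - s‖ := by
      have h1 := norm_sub_norm_le (z - c) (s - c)
      rw [sub_sub_sub_cancel_right] at h1
      linarith
    have hzs0 : z - s ≠ 0 := by
      rw [← norm_pos_iff]; linarith
    have hzc0 : z - c ≠ 0 := by
      rw [← norm_pos_iff]; linarith
    have e : (z - s)⁻¹ * logDeriv f z - (z - c)⁻¹ * logDeriv f z =
        (s - c) * logDeriv f z / ((z - s) * (z - c)) := by
      field_simp
      ring
    rw [e, norm_div, norm_mul, norm_mul, hz', div_le_div_iff₀ (by positivity) (by positivity)]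
    have hL := (hcirc z hz').2
    calc ‖s - c‖ * ‖logDeriv f z‖ * (R * R) ≤ ‖s - c‖ * (C₁ * ℓ ^ 2) * (R * R) := by gcongr
      _ = 2 * ‖s - c‖ * (C₁ * ℓ ^ 2) * (R / 2 * R) := by ring
      _ ≤ 2 * ‖s - c‖ * (C₁ * ℓ ^ 2) * (‖z - s‖ * R) := by gcongr
  have hcn : ‖∮ z in C(c, R), (z - c)⁻¹ * logDeriv f z‖ ≤
      C₂ * ℓ / √R + 4 * (C₁ * ℓ ^ 2) * δ := by
    rw [hcenter, norm_mul, Complex.norm_I, one_mul]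
    exact hm
  have hall : 2 * π * ‖logDeriv f s - ∑ ρ ∈ h.zeros _ (isCompact_closedBall c R),
      (zeroOrder f ρ : ℂ) / (s - ρ)‖ ≤
      C₂ * ℓ / √R + 4 * (C₁ * ℓ ^ 2) * δ + 2 * π * (2 * ‖s - c‖ * C₁ * (ℓ ^ 2 / R)) := by
    have h1 := norm_add_le ((∮ z in C(c, R), (z - s)⁻¹ * logDeriv f z) -
      ∮ z in C(c, R), (z - c)⁻¹ * logDeriv f z) (∮ z in C(c, R), (z - c)⁻¹ * logDeriv f z)
    have h2 := h1.trans (add_le_add hdiff hcn)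
    rw [sub_add_cancel, hres, norm_mul, norm_mul, norm_mul, Complex.norm_I,
      Complex.norm_of_nonneg Real.pi_pos.le, Complex.norm_ofNat, mul_one] at h2
    linarith
  set X := ‖logDeriv f s - ∑ ρ ∈ h.zeros _ (isCompact_closedBall c R),
      (zeroOrder f ρ : ℂ) / (s - ρ)‖ with hX
  set Y := ℓ ^ 2 / √R with hY
  have hYpos : 0 ≤ Y := by positivity
  have e1 : C₂ * ℓ / √R ≤ 2 * C₂ * Y := by
    rw [hY, ← mul_div_assoc]
    refine div_le_div_of_nonneg_right ?_ hsq.le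
    have : ℓ ≤ 2 * ℓ ^ 2 := by nlinarith
    nlinarith
  have e2 : 4 * (C₁ * ℓ ^ 2) * δ = 4 * C₁ * Y := by rw [hY, hδ]; ring
  have e3 : ℓ ^ 2 / R ≤ Y := by
    rw [hY]
    gcongr
    nlinarith
  have e4 : 2 * ‖s - c‖ * C₁ * (ℓ ^ 2 / R) ≤ 2 * ‖s - c‖ * C₁ * Y := by gcongr
  have e5 : 0 ≤ 2 * C₂ * Y + 4 * C₁ * Y := by positivity
  have hpi1 : 1 ≤ 2 * π := by linarith [Real.two_le_pi]
  have e6 : 2 * π * X ≤ 2 * π * ((2 * C₂ + 4 * C₁ + 2 * ‖s - c‖ * C₁) * Y) := by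
    have : 2 * C₂ * Y + 4 * C₁ * Y ≤ 2 * π * (2 * C₂ * Y + 4 * C₁ * Y) :=
      le_mul_of_one_le_left e5 hpi1
    have : 2 * π * (2 * ‖s - c‖ * C₁ * (ℓ ^ 2 / R)) ≤ 2 * π * (2 * ‖s - c‖ * C₁ * Y) := by gcongr
    linarith
  exact le_of_mul_le_mul_left e6 (by linarith)

/-- The symmetric sum over zeros of `1 / (s - ρ)` converges to the logarithmic derivative. -/
theorem tendsto_tsum (h : TemperedFE f σ A ω) {s : ℂ} (hs : f s ≠ 0) :
    Tendsto (fun T : ℝ => ∑' ρ : {ρ : ℂ // f ρ = 0 ∧ |ρ.im| ≤ T}, (zeroOrder f ρ : ℂ) / (s - ρ))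
      atTop (𝓝 (logDeriv f s)) := by
  classical
  have hA := h.one_le
  obtain ⟨D, R₁, hD, hR₁, happ⟩ := h.exists_disc_approx hs
  obtain ⟨C, hC, hstrip⟩ := h.exists_strip_bound (W := A + 1) (by linarith)
  rw [Metric.tendsto_atTop]
  intro ε hε
  have hlim := (tendsto_log_two_add_sq_div_sqrt.const_mul (D + 4 * C))
  rw [mul_zero] at hlim
  obtain ⟨R₂, hR₂⟩ := eventually_atTop.mp (hlim.eventually_lt_const hε)
  refine ⟨max (max R₁ R₂) (2 * ‖s‖ + A + 1), fun T hT => ?_⟩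
  have hT1 : R₁ ≤ T := (le_max_left _ _).trans ((le_max_left _ _).trans hT)
  have hT2 : R₂ ≤ T := (le_max_right _ _).trans ((le_max_left _ _).trans hT)
  have hT3 : 2 * ‖s‖ + A + 1 ≤ T := (le_max_right _ _).trans hT
  have hsn := norm_nonneg s
  obtain ⟨R, hR, hdisc⟩ := happ (T + A) (by linarith)
  set c : ℂ := ((σ / 2 : ℝ) : ℂ) with hc
  set S := h.zeros _ (isCompact_closedBall c R) with hS
  have hRpos : 0 < R := by linarith [hR.1]
  have hset : {ρ : ℂ | f ρ = 0 ∧ |ρ.im| ≤ T} = (S.filter fun ρ => |ρ.im| ≤ T : Finset ℂ) := by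
    ext ρ
    simp only [Set.mem_ofPred_eq, Finset.coe_filter, hS, h.mem_zeros, Metric.mem_closedBall,
      dist_eq_norm]
    constructor
    · rintro ⟨h0, h1⟩
      exact ⟨⟨h0, by linarith [(h.abs_norm_sub_abs_im_lt h0).1, hR.1]⟩, h1⟩
    · rintro ⟨⟨h0, -⟩, h1⟩
      exact ⟨h0, h1⟩
  have htsum : ∑' ρ : {ρ : ℂ // f ρ = 0 ∧ |ρ.im| ≤ T}, (zeroOrder f ρ : ℂ) / (s - ρ) =
      ∑ ρ ∈ S.filter fun ρ => |ρ.im| ≤ T, (zeroOrder f ρ : ℂ) / (s - ρ) := by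
    change ∑' ρ : ({ρ : ℂ | f ρ = 0 ∧ |ρ.im| ≤ T} : Set ℂ), (zeroOrder f ρ : ℂ) / (s - ρ) = _
    rw [hset, Finset.tsum_subtype' (S.filter fun ρ => |ρ.im| ≤ T)
      (fun ρ => (zeroOrder f ρ : ℂ) / (s - ρ))]
  have hlogle : Real.log (2 + T) ≤ Real.log (2 + R) :=
    Real.log_le_log (by linarith) (by linarith [hR.1])
  have hextra : ‖∑ ρ ∈ S.filter fun ρ => ¬ |ρ.im| ≤ T, (zeroOrder f ρ : ℂ) / (s - ρ)‖ ≤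
      C * Real.log (2 + R) * (2 / R) := by
    have hcount := hstrip T (by linarith) (S.filter fun ρ => ¬ |ρ.im| ≤ T) (by
      intro ρ hρ
      obtain ⟨h1, h2⟩ := Finset.mem_filter.mp hρ
      obtain ⟨h3, h4⟩ := (h.mem_zeros _).mp h1
      rw [Metric.mem_closedBall, dist_eq_norm] at h4
      exact ⟨h3, (not_le.mp h2).le, by linarith [(h.abs_norm_sub_abs_im_lt h3).2, hR.2]⟩)
    refine (norm_sum_le _ _).trans ?_
    refine le_trans ?_ (mul_le_mul_of_nonneg_right (hcount.trans
      (mul_le_mul_of_nonneg_left hlogle hC.le)) (by positivity))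
    rw [Finset.sum_mul]
    refine Finset.sum_le_sum fun ρ hρ => ?_
    rw [norm_div, Complex.norm_natCast, div_eq_mul_inv]
    gcongr
    have him := not_le.mp (Finset.mem_filter.mp hρ).2
    have h1 : R / 2 ≤ ‖s - ρ‖ := by
      have h2 := norm_sub_norm_le ρ s
      rw [norm_sub_rev] at h2
      have h3 := Complex.abs_im_le_norm ρ
      linarith [hR.2]
    rw [inv_le_comm₀ (by linarith) (by positivity), inv_div]
    exact h1
  have hfin := hR₂ R (by linarith [hR.1])
  rw [htsum, dist_comm, dist_eq_norm]
  refine lt_of_le_of_lt ?_ hfin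
  rw [← Finset.sum_filter_add_sum_filter_not S (fun ρ => |ρ.im| ≤ T)] at hdisc
  set a := ∑ ρ ∈ S.filter fun ρ => |ρ.im| ≤ T, (zeroOrder f ρ : ℂ) / (s - ρ)
  set b := ∑ ρ ∈ S.filter fun ρ => ¬ |ρ.im| ≤ T, (zeroOrder f ρ : ℂ) / (s - ρ)
  have h1 : ‖logDeriv f s - a‖ ≤ ‖logDeriv f s - (a + b)‖ + ‖b‖ := by
    have := norm_add_le (logDeriv f s - (a + b)) b
    rwa [show logDeriv f s - (a + b) + b = logDeriv f s - a by ring] at this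
  have hsq : 0 < √R := Real.sqrt_pos.mpr hRpos
  have hsqR : √R * √R = R := Real.mul_self_sqrt hRpos.le
  have hsq1 : 1 ≤ √R := Real.one_le_sqrt.mpr (by linarith [hR.1])
  have hℓ : 1 / 2 ≤ Real.log (2 + R) := half_le_log_two_add hRpos.le
  have h2 : C * Real.log (2 + R) * (2 / R) ≤ 4 * C * (Real.log (2 + R) ^ 2 / √R) := by
    have e1 : Real.log (2 + R) ≤ 2 * Real.log (2 + R) ^ 2 := by nlinarith
    have e2 : 2 / R ≤ 2 / √R := by gcongr; nlinarith
    calc C * Real.log (2 + R) * (2 / R) ≤ C * (2 * Real.log (2 + R) ^ 2) * (2 / √R) := by gcongr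
      _ = _ := by ring
  rw [add_mul]
  linarith

end TemperedFE

section PolynomialComparison

variable {ι : Type*} {N : ι → ℝ} {V : Set ι}

/-- `f` is bounded by `g` on `V` up to a power of the size function `N`. -/
def PolyLE (N : ι → ℝ) (V : Set ι) (f g : ι → ℂ) : Prop :=
  ∃ k : ℕ, ∀ x ∈ V, ‖f x‖ ≤ (2 + N x) ^ k * ‖g x‖

lemma exists_le_two_add_pow (C : ℝ) : ∃ k : ℕ, ∀ x : ℝ, 0 ≤ x → C ≤ (2 + x) ^ k := by
  obtain ⟨k, hk⟩ := pow_unbounded_of_one_lt C (one_lt_two : (1 : ℝ) < 2)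
  exact ⟨k, fun x hx => hk.le.trans (by gcongr; linarith)⟩

lemma PolyLE.of_const_mul {f g : ι → ℂ} (hN : ∀ x, 0 ≤ N x) (C : ℝ) (k : ℕ)
    (h : ∀ x ∈ V, ‖f x‖ ≤ C * (2 + N x) ^ k * ‖g x‖) : PolyLE N V f g := by
  obtain ⟨j, hj⟩ := exists_le_two_add_pow C
  refine ⟨j + k, fun x hx => (h x hx).trans ?_⟩
  rw [pow_add]
  have := hN x
  gcongr
  exact hj _ (hN x)

lemma PolyLE.of_const {f g : ι → ℂ} (hN : ∀ x, 0 ≤ N x) (C : ℝ)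
    (h : ∀ x ∈ V, ‖f x‖ ≤ C * ‖g x‖) : PolyLE N V f g :=
  PolyLE.of_const_mul hN C 0 (by simpa using h)

lemma PolyLE.mul {f g f' g' : ι → ℂ} (hN : ∀ x, 0 ≤ N x) (h : PolyLE N V f g)
    (h' : PolyLE N V f' g') : PolyLE N V (fun x => f x * f' x) (fun x => g x * g' x) := by
  obtain ⟨k, hk⟩ := h
  obtain ⟨k', hk'⟩ := h'
  refine ⟨k + k', fun x hx => ?_⟩
  have := hN x
  rw [norm_mul, norm_mul, pow_add]
  calc ‖f x‖ * ‖f' x‖ ≤ ((2 + N x) ^ k * ‖g x‖) * ((2 + N x) ^ k' * ‖g' x‖) := by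
        gcongr
        exacts [hk x hx, hk' x hx]
    _ = _ := by ring

lemma PolyLE.prod {κ : Type*} (s : Finset κ) {f g : κ → ι → ℂ} (hN : ∀ x, 0 ≤ N x)
    (h : ∀ i ∈ s, PolyLE N V (f i) (g i)) :
    PolyLE N V (fun x => ∏ i ∈ s, f i x) (fun x => ∏ i ∈ s, g i x) := by
  classical
  induction s using Finset.induction_on with
  | empty => exact PolyLE.of_const hN 1 (by simp)
  | insert a s ha ih =>
    simp only [Finset.prod_insert ha]
    exact (h a (Finset.mem_insert_self _ _)).mul hN
      (ih fun i hi => h i (Finset.mem_insert_of_mem hi))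

lemma PolyLE.pow {f g : ι → ℂ} (hN : ∀ x, 0 ≤ N x) (h : PolyLE N V f g) (n : ℕ) :
    PolyLE N V (fun x => f x ^ n) (fun x => g x ^ n) := by
  have := PolyLE.prod (Finset.range n) (f := fun _ => f) (g := fun _ => g) hN fun _ _ => h
  simpa using this

end PolynomialComparison

section GammaRatio

lemma norm_betaIntegral_le_one {u v : ℂ} (hu : 1 ≤ u.re) (hv : 1 ≤ v.re) :
    ‖Complex.betaIntegral u v‖ ≤ 1 := by
  have key : ∀ (w : ℂ) (x : ℝ), 1 ≤ w.re → 0 ≤ x → x ≤ 1 → ‖(x : ℂ) ^ (w - 1)‖ ≤ 1 := by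
    intro w x hw h0 h1
    rcases h0.eq_or_lt with h | h
    · subst h
      by_cases hw1 : w - 1 = 0
      · simp [hw1]
      · simp [Complex.zero_cpow hw1]
    · rw [Complex.norm_cpow_eq_rpow_re_of_pos h]
      exact Real.rpow_le_one h0 h1 (by simpa using hw)
  rw [Complex.betaIntegral]
  refine (intervalIntegral.norm_integral_le_of_norm_le_const (C := 1) fun x hx => ?_).trans_eq
    (by simp)
  rw [Set.uIoc_of_le zero_le_one] at hx
  rw [norm_mul]
  have h2 := key v (1 - x) hv (by linarith [hx.2]) (by linarith [hx.1])
  push_cast at h2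
  exact mul_le_one₀ (key u x hu hx.1.le hx.2) (norm_nonneg _) h2

lemma one_le_norm_of_good {w : ℂ} (hw : 1 ≤ w.re ∨ 1 ≤ |w.im|) : 1 ≤ ‖w‖ := by
  rcases hw with h | h
  · exact h.trans ((le_abs_self _).trans (Complex.abs_re_le_norm w))
  · exact h.trans (Complex.abs_im_le_norm w)

lemma Gamma_ne_zero_of_good {w : ℂ} (hw : 1 ≤ w.re ∨ 1 ≤ |w.im|) : Complex.Gamma w ≠ 0 := by
  refine Complex.Gamma_ne_zero fun m h => ?_
  rw [h] at hw
  have : (0 : ℝ) ≤ m := Nat.cast_nonneg m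
  rcases hw with h1 | h1
  · simp at h1
    linarith
  · norm_num at h1

lemma good_add_nat {w : ℂ} (hw : 1 ≤ w.re ∨ 1 ≤ |w.im|) (n : ℕ) :
    1 ≤ (w + n).re ∨ 1 ≤ |(w + n).im| := by
  rcases hw with h | h
  · left; simp; linarith [(Nat.cast_nonneg n : (0 : ℝ) ≤ n)]
  · right; simpa using h

lemma norm_Gamma_le_add_nat {w : ℂ} (hw : 1 ≤ w.re ∨ 1 ≤ |w.im|) (n : ℕ) :
    ‖Complex.Gamma w‖ ≤ ‖Complex.Gamma (w + n)‖ := by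
  induction n with
  | zero => simp
  | succ n ih =>
    have h1 := one_le_norm_of_good (good_add_nat hw n)
    have h2 : w + n ≠ 0 := by rw [← norm_pos_iff]; linarith
    push_cast
    rw [← add_assoc, Complex.Gamma_add_one _ h2, norm_mul]
    exact ih.trans (le_mul_of_one_le_left (norm_nonneg _) h1)

lemma norm_Gamma_add_nat_le {w : ℂ} (hw : 1 ≤ w.re ∨ 1 ≤ |w.im|) (n : ℕ) :
    ‖Complex.Gamma (w + n)‖ ≤ (‖w‖ + n) ^ n * ‖Complex.Gamma w‖ := by
  have key : ∀ m ≤ n, ‖Complex.Gamma (w + m)‖ ≤ (‖w‖ + n) ^ m * ‖Complex.Gamma w‖ := by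
    intro m hm
    induction m with
    | zero => simp
    | succ m ih =>
      have h1 := one_le_norm_of_good (good_add_nat hw m)
      have h2 : w + m ≠ 0 := by rw [← norm_pos_iff]; linarith
      push_cast
      rw [← add_assoc, Complex.Gamma_add_one _ h2, norm_mul, pow_succ']
      rw [mul_assoc]
      gcongr
      · refine (norm_add_le _ _).trans ?_
        rw [Complex.norm_natCast]
        have : (m : ℝ) ≤ n := by exact_mod_cast (by omega : m ≤ n)
        linarith
      · exact ih (by omega)
  exact key n le_rfl

/-- Values of `Γ` at nearby points differ at most by a power of the argument. -/
lemma exists_norm_Gamma_le (m₀ K : ℝ) : ∃ C : ℝ, ∃ k : ℕ, 0 < C ∧ ∀ w w' : ℂ,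
    (1 ≤ w.re ∨ 1 ≤ |w.im|) → (1 ≤ w'.re ∨ 1 ≤ |w'.im|) → -m₀ ≤ w'.re → ‖w' - w‖ ≤ K →
    ‖Complex.Gamma w'‖ ≤ C * (2 + ‖w‖) ^ k * ‖Complex.Gamma w‖ := by
  obtain ⟨m, hm⟩ := exists_nat_ge (m₀ + 1)
  obtain ⟨l, hl⟩ := exists_nat_ge (K + 1)
  set n := m + l with hn
  set Ω : Set ℂ := Metric.closedBall 0 (l + K) ∩ {u | 1 ≤ u.re} with hΩ
  have hΩc : IsCompact Ω := (isCompact_closedBall _ _).inter_right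
    (isClosed_le continuous_const Complex.continuous_re)
  have hcont : ContinuousOn (fun u => ‖(Complex.Gamma u)⁻¹‖) Ω := by
    refine ContinuousOn.norm (ContinuousOn.inv₀ (fun u hu => ?_)
      fun u hu => Gamma_ne_zero_of_good (Or.inl hu.2))
    refine (Complex.differentiableAt_Gamma u fun j h => ?_).continuousAt.continuousWithinAt
    have h1 : 1 ≤ u.re := hu.2
    rw [h] at h1
    simp at h1
    linarith [(Nat.cast_nonneg j : (0 : ℝ) ≤ j)]
  obtain ⟨C, hC⟩ := hΩc.bddAbove_image hcont
  refine ⟨max C 1 * ((n : ℝ) + 1) ^ n, n, by positivity, fun w w' hw hw' hre hK => ?_⟩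
  have hreK := (abs_le.mp ((Complex.abs_re_le_norm (w' - w)).trans hK)).2
  simp only [Complex.sub_re] at hreK
  set u : ℂ := w - w' + l with hu
  have hure : 1 ≤ u.re := by
    simp [hu]; linarith
  have huΩ : u ∈ Ω := by
    refine ⟨?_, hure⟩
    rw [Metric.mem_closedBall, dist_zero_right, hu]
    refine (norm_add_le _ _).trans ?_
    rw [Complex.norm_natCast, norm_sub_rev]
    linarith
  have hv : 1 ≤ (w' + m).re := by simp; linarith
  have hbeta := Complex.Gamma_mul_Gamma_eq_betaIntegral (s := w' + m) (t := u) (by linarith)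
    (by linarith)
  have hsum : w' + m + u = w + n := by rw [hu, hn]; push_cast; ring
  rw [hsum] at hbeta
  have hΓu := Gamma_ne_zero_of_good (Or.inl hure : 1 ≤ u.re ∨ 1 ≤ |u.im|)
  have hCu : ‖(Complex.Gamma u)⁻¹‖ ≤ max C 1 :=
    (hC (Set.mem_image_of_mem _ huΩ)).trans (le_max_left _ _)
  have h1 : Complex.Gamma (w' + m) =
      Complex.Gamma (w + n) * Complex.betaIntegral (w' + m) u * (Complex.Gamma u)⁻¹ := by
    rw [← hbeta, mul_assoc, mul_inv_cancel₀ hΓu, mul_one]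
  calc ‖Complex.Gamma w'‖ ≤ ‖Complex.Gamma (w' + m)‖ := norm_Gamma_le_add_nat hw' m
    _ ≤ ‖Complex.Gamma (w + n)‖ * 1 * max C 1 := by
      rw [h1, norm_mul, norm_mul]
      gcongr
      exact norm_betaIntegral_le_one hv hure
    _ ≤ (((n : ℝ) + 1) * (2 + ‖w‖)) ^ n * ‖Complex.Gamma w‖ * 1 * max C 1 := by
      gcongr
      refine (norm_Gamma_add_nat_le hw n).trans ?_
      gcongr
      nlinarith [norm_nonneg w, (Nat.cast_nonneg n : (0 : ℝ) ≤ n)]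
    _ = _ := by rw [mul_pow]; ring

end GammaRatio

section DirichletSeriesBounds

lemma LSeriesHasSum_of_hasSum_nat_add {f : ℕ → ℂ} {s b : ℂ} {k : ℕ} (hf : ∀ n < k, f n = 0)
    (hk : k ≠ 0) (h : HasSum (fun n : ℕ => f (n + k) * ((n + k : ℕ) : ℂ) ^ (-s)) b) :
    LSeriesHasSum f s b := by
  have h0 : ∑ i ∈ Finset.range k, LSeries.term f s i = 0 :=
    Finset.sum_eq_zero fun i hi => by
      simp [LSeries.term, hf i (Finset.mem_range.mp hi)]
  rw [LSeriesHasSum, ← hasSum_nat_add_iff' k, h0, sub_zero]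
  refine h.congr_fun ?_ 
  intro n
  rw [LSeries.term_of_ne_zero (by omega), Complex.cpow_neg, div_eq_mul_inv]

/-- On a far right half-plane a Dirichlet series stays close to its first coefficient. -/
lemma eventually_norm_LSeries_sub_le {f : ℕ → ℂ} (hf : LSeries.abscissaOfAbsConv f < ⊤)
    {ε : ℝ} (hε : 0 < ε) :
    ∀ᶠ x : ℝ in atTop, ∀ z : ℂ, z.re = x → ‖LSeries f z - f 1‖ ≤ ε := by
  set g : ℕ → ℂ := fun n => (‖f n‖ : ℂ) with hg
  have hterm : ∀ z : ℂ, (fun n => LSeries.term g z.re n) =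
      fun n => ((‖LSeries.term f z n‖ : ℝ) : ℂ) := by
    intro z
    ext n
    rcases eq_or_ne n 0 with rfl | hn
    · simp
    rw [LSeries.term_of_ne_zero hn, LSeries.norm_term_eq, if_neg hn, hg]
    push_cast
    rw [Complex.ofReal_cpow (Nat.cast_nonneg n)]
    simp
  have hgsum : ∀ z : ℂ, LSeriesSummable f z → LSeriesSummable g z.re := by
    intro z hz
    rw [LSeriesSummable]
    refine Summable.congr ?_ fun n => (congrFun (hterm z) n).symm
    exact_mod_cast hz.norm
  have hga : LSeries.abscissaOfAbsConv g < ⊤ := by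
    obtain ⟨x, hx1, hx2⟩ := EReal.lt_iff_exists_real_btwn.mp hf
    have := hgsum x (LSeriesSummable_of_abscissaOfAbsConv_lt_re (by simpa using hx1))
    exact this.abscissaOfAbsConv_le.trans_lt (EReal.coe_lt_top _)
  obtain ⟨x₀, hx1, hx2⟩ := EReal.lt_iff_exists_real_btwn.mp hf
  have hlim := LSeries.tendsto_atTop hga
  filter_upwards [hlim.eventually (Metric.ball_mem_nhds _ hε), eventually_ge_atTop x₀]
    with x hx hxx₀ z hz
  have hs : LSeriesSummable f z := LSeriesSummable_of_abscissaOfAbsConv_lt_re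
    (hx1.trans_le (by rw [hz]; exact_mod_cast hxx₀))
  have hsplit : ∀ (φ : ℕ → ℂ) (w : ℂ), LSeriesSummable φ w →
      LSeries φ w - φ 1 = ∑' n, LSeries.term φ w (n + 2) := by
    intro φ w hφ
    rw [LSeries, ← hφ.sum_add_tsum_nat_add 2]
    simp [Finset.sum_range_succ, LSeries.term]
  rw [hsplit f z hs]
  have hnorm : Summable fun n => ‖LSeries.term f z (n + 2)‖ :=
    (summable_nat_add_iff 2).mpr hs.norm
  refine (norm_tsum_le_tsum_norm hnorm).trans ?_
  have h2 := hsplit g z.re (hgsum z hs)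
  have h3 : ∑' n, LSeries.term g z.re (n + 2) = ((∑' n, ‖LSeries.term f z (n + 2)‖ : ℝ) : ℂ) := by
    rw [Complex.ofReal_tsum]
    exact tsum_congr fun n => congrFun (hterm z) (n + 2)
  rw [h3, hz] at h2
  rw [dist_eq_norm, h2, Complex.norm_real, Real.norm_eq_abs] at hx
  exact (le_abs_self _).trans hx.le

/-- A Dirichlet series whose logarithmic derivative has no constant term starts at `n = 1`. -/
lemma LSeries_coeff_one_ne_zero {f g : ℕ → ℂ} (hf0 : f 0 = 0) (hf : f ≠ 0) (hg1 : g 1 = 0)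
    (haf : LSeries.abscissaOfAbsConv f < ⊤) (hag : LSeries.abscissaOfAbsConv g < ⊤)
    (h : ∀ᶠ x : ℝ in atTop, -(deriv (LSeries f) x / LSeries f x) = LSeries g x) : f 1 ≠ 0 := by
  classical
  have hex : ∃ n, f n ≠ 0 := Function.ne_iff.mp hf
  obtain ⟨p, hp⟩ : ∃ p, Nat.find hex = p + 1 :=
    Nat.exists_eq_succ_of_ne_zero fun h0 => (h0 ▸ Nat.find_spec hex) hf0
  have hp0 : f (p + 1) ≠ 0 := hp ▸ Nat.find_spec hex
  have hsmall : ∀ m ≤ p, f m = 0 := fun m hm => by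
    simpa using Nat.find_min hex (m := m) (by omega)
  have l1 := LSeries.tendsto_cpow_mul_atTop hsmall haf
  have l2 := LSeries.tendsto_cpow_mul_atTop (f := LSeries.logMul f) (n := p)
    (fun m hm => by simp [LSeries.logMul, hsmall m hm])
    (by rwa [LSeries.abscissaOfAbsConv_logMul])
  have l3 := (l2.div l1 hp0)
  have l4 : Tendsto (fun x : ℝ => LSeries g x) atTop (𝓝 (g 1)) := LSeries.tendsto_atTop hag
  obtain ⟨x₀, hx1, hx2⟩ := EReal.lt_iff_exists_real_btwn.mp haf
  have heq : (fun x : ℝ => LSeries g x) =ᶠ[atTop] fun x : ℝ =>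
      -(((p + 1 : ℂ) ^ (x : ℂ) * LSeries (LSeries.logMul f) x) /
        ((p + 1 : ℂ) ^ (x : ℂ) * LSeries f x)) * (-1) := by
    filter_upwards [h, eventually_ge_atTop x₀] with x hx hxx
    rw [← hx, LSeries_deriv (hx1.trans_le (by simpa using hxx)),
      mul_div_mul_left _ _ (Complex.natCast_add_one_cpow_ne_zero p x)]
    ring
  have key := tendsto_nhds_unique (l4.congr' heq) (l3.neg.mul_const (-1))
  rw [hg1, LSeries.logMul, mul_div_assoc, div_self hp0] at key
  have hlog : Complex.log ((p + 1 : ℕ) : ℂ) = 0 := by simpa using key.symm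
  rw [← Complex.natCast_log, Complex.ofReal_eq_zero, Real.log_eq_zero] at hlog
  have hp1 : p + 1 = 1 := by
    rcases hlog with h1 | h1 | h1
    · exact absurd h1 (by positivity)
    · exact_mod_cast h1
    · exact absurd h1 (by
        have : (0 : ℝ) ≤ ((p + 1 : ℕ) : ℝ) := Nat.cast_nonneg _
        linarith)
  rwa [hp1] at hp0

end DirichletSeriesBounds

namespace SSF

variable {σ0 σ1 : ℝ} (S : SSF σ0 σ1)

/-- The Dirichlet coefficients of `F`, as an arithmetic function vanishing at `0`. -/
def coeff (n : ℕ) : ℂ := if n = 0 then 0 else S.a n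

/-- The Dirichlet coefficients of `-F'/F`, vanishing at `0` and `1`. -/
def logCoeff (n : ℕ) : ℂ := if n < 2 then 0 else S.c n

lemma hasSum_coeff {s : ℂ} (hs : σ0 < s.re) : LSeriesHasSum S.coeff s (S.F s) := by
  refine LSeriesHasSum_of_hasSum_nat_add (k := 1) (by simp [coeff]) one_ne_zero ?_
  simpa [coeff] using S.hDir s hs

lemma hasSum_logCoeff {s : ℂ} (hs : σ0 < s.re) :
    LSeriesHasSum S.logCoeff s (-(deriv S.F s / S.F s)) := by
  refine LSeriesHasSum_of_hasSum_nat_add (k := 2) (fun n hn => by simp [logCoeff, hn])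
    two_ne_zero ?_
  simpa [logCoeff] using S.hEuler s hs

lemma abscissa_le {f : ℕ → ℂ} {φ : ℂ → ℂ} (h : ∀ s : ℂ, σ0 < s.re → LSeriesHasSum f s (φ s)) :
    LSeries.abscissaOfAbsConv f ≤ σ0 :=
  LSeries.abscissaOfAbsConv_le_of_forall_lt_LSeriesSummable fun y hy =>
    (h y (by simpa using hy)).LSeriesSummable

lemma deriv_F_eq {s : ℂ} (hs : σ0 < s.re) : deriv S.F s = deriv (LSeries S.coeff) s := by
  refine Filter.EventuallyEq.deriv_eq ?_
  filter_upwards [(isOpen_lt continuous_const Complex.continuous_re).mem_nhds hs] with z hz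
  exact (S.hasSum_coeff hz).LSeries_eq.symm

lemma eventually_F_bounds (hF : S.coeff ≠ 0) : ∃ c C : ℝ, 0 < c ∧ ∀ᶠ A : ℝ in atTop,
    ∀ z : ℂ, A ≤ z.re → c ≤ ‖S.F z‖ ∧ ‖S.F z‖ ≤ C := by
  have ha : LSeries.abscissaOfAbsConv S.coeff < ⊤ :=
    (abscissa_le fun s hs => S.hasSum_coeff hs).trans_lt (EReal.coe_lt_top _)
  have h1 : S.coeff 1 ≠ 0 := by
    refine LSeries_coeff_one_ne_zero (g := S.logCoeff) (by simp [coeff]) hF (by simp [logCoeff]) ha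
      ((abscissa_le fun s hs => S.hasSum_logCoeff hs).trans_lt (EReal.coe_lt_top _)) ?_
    filter_upwards [eventually_gt_atTop σ0] with x hx
    have hx' : σ0 < (x : ℂ).re := by simpa using hx
    rw [(S.hasSum_logCoeff hx').LSeries_eq, (S.hasSum_coeff hx').LSeries_eq, S.deriv_F_eq hx']
  have hpos : 0 < ‖S.coeff 1‖ := norm_pos_iff.mpr h1
  refine ⟨‖S.coeff 1‖ / 2, 2 * ‖S.coeff 1‖, by positivity, ?_⟩
  filter_upwards [eventually_forall_ge_atTop.mpr
    ((eventually_norm_LSeries_sub_le ha (half_pos hpos)).and (eventually_gt_atTop σ0))]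
    with A hA z hz
  obtain ⟨h2, h3⟩ := hA z.re hz
  have h4 := h2 z rfl
  rw [(S.hasSum_coeff h3).LSeries_eq] at h4
  have h5 := norm_sub_norm_le (S.F z) (S.coeff 1)
  have h6 := norm_sub_norm_le (S.coeff 1) (S.F z)
  rw [norm_sub_rev] at h6
  constructor <;> linarith

/-- The archimedean factor of `ξ_F` together with the polynomial at the reflected poles. -/
def H (s : ℂ) : ℂ := (S.Q : ℂ) ^ s * (∏ j, Complex.Gamma ((S.lam j : ℂ) * s + S.mu j)) *
  ∏ i : Fin S.N, (if 2 * S.M + S.dlt ≤ (i : ℕ) then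
    ((σ1 : ℂ) - s - (starRingEnd ℂ) (S.pole i)) ^ S.m i else 1)

/-- Thresholds `A`, `T` beyond which all factors of `ξ_F` are well behaved. -/
structure Regular (A T : ℝ) : Prop where
  one_le : 1 ≤ A
  sigma_le : σ1 ≤ A
  pole_re : ∀ i, (S.pole i).re + 1 ≤ A
  pole_re' : ∀ i, σ1 - (S.pole i).re + 1 ≤ A
  pole_im : ∀ i, |(S.pole i).im| + 1 ≤ T
  gamma_re : ∀ j, 1 ≤ S.lam j * A + (S.mu j).re
  gamma_im : ∀ j, 1 ≤ S.lam j * T - |(S.mu j).im|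

/-- The region where the factors of `ξ_F` are well behaved. -/
def region (σ1 A T : ℝ) : Set ℂ := {z | σ1 - A ≤ z.re ∧ (A ≤ z.re ∨ T ≤ |z.im|)}

lemma eventually_const_le_mul {l : ℝ} (hl : 0 < l) (b : ℝ) :
    ∀ᶠ A : ℝ in atTop, b ≤ l * A :=
  (tendsto_id.const_mul_atTop hl).eventually_ge_atTop b

lemma exists_regular {p : ℝ → Prop} (hp : ∀ᶠ A in atTop, p A) :
    ∃ A T, S.Regular A T ∧ p A := by
  have h1 : ∀ᶠ A : ℝ in atTop, ∀ j, 1 - (S.mu j).re ≤ S.lam j * A :=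
    eventually_all.mpr fun j => eventually_const_le_mul (S.hlam j) _
  have h2 : ∀ᶠ T : ℝ in atTop, ∀ j, 1 + |(S.mu j).im| ≤ S.lam j * T :=
    eventually_all.mpr fun j => eventually_const_le_mul (S.hlam j) _
  have h3 : ∀ᶠ A : ℝ in atTop, ∀ i, (S.pole i).re + 1 ≤ A :=
    eventually_all.mpr fun i => eventually_ge_atTop _
  have h4 : ∀ᶠ A : ℝ in atTop, ∀ i, σ1 - (S.pole i).re + 1 ≤ A :=
    eventually_all.mpr fun i => eventually_ge_atTop _
  have h5 : ∀ᶠ T : ℝ in atTop, ∀ i, |(S.pole i).im| + 1 ≤ T :=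
    eventually_all.mpr fun i => eventually_ge_atTop _
  obtain ⟨A, ⟨⟨⟨⟨a1, a2⟩, a3⟩, a4⟩, a5⟩, a6⟩ := (((((eventually_ge_atTop 1).and
    (eventually_ge_atTop σ1)).and h1).and h3).and h4 |>.and hp).exists
  obtain ⟨T, b2, b3⟩ := (h2.and h5).exists
  exact ⟨A, T, ⟨a1, a2, a4, a5, b3, fun j => by linarith [a3 j],
    fun j => by linarith [b2 j]⟩, a6⟩

variable {S} {A T : ℝ}

lemma one_le_norm_sub {a z : ℂ} (h : a.re + 1 ≤ A) (h' : |a.im| + 1 ≤ T)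
    (hz : A ≤ z.re ∨ T ≤ |z.im|) : 1 ≤ ‖z - a‖ := by
  rcases hz with hz | hz
  · have := (le_abs_self _).trans (Complex.abs_re_le_norm (z - a))
    simp only [Complex.sub_re] at this
    linarith
  · have := Complex.abs_im_le_norm (z - a)
    simp only [Complex.sub_im] at this
    linarith [abs_sub_abs_le_abs_sub z.im a.im]

lemma Regular.one_le_norm_sub_pole (h : S.Regular A T) {z : ℂ} (hz : A ≤ z.re ∨ T ≤ |z.im|)
    (i : Fin S.N) : 1 ≤ ‖z - S.pole i‖ :=
  one_le_norm_sub (h.pole_re i) (h.pole_im i) hz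

lemma Regular.one_le_norm_reflect_sub_pole (h : S.Regular A T) {z : ℂ}
    (hz : A ≤ z.re ∨ T ≤ |z.im|) (i : Fin S.N) :
    1 ≤ ‖(σ1 : ℂ) - z - (starRingEnd ℂ) (S.pole i)‖ := by
  have := one_le_norm_sub (a := σ1 - (starRingEnd ℂ) (S.pole i)) (by simpa using h.pole_re' i)
    (by simpa using h.pole_im i) hz
  rw [norm_sub_rev] at this
  rwa [sub_right_comm]

lemma Regular.good (h : S.Regular A T) {z : ℂ} (hz : A ≤ z.re ∨ T ≤ |z.im|) (j : Fin S.r) :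
    1 ≤ ((S.lam j : ℂ) * z + S.mu j).re ∨ 1 ≤ |((S.lam j : ℂ) * z + S.mu j).im| := by
  have hl := S.hlam j
  rcases hz with hz | hz
  · left
    simp
    nlinarith [h.gamma_re j]
  · right
    simp
    have h1 := abs_sub_abs_le_abs_sub (S.lam j * z.im) (-(S.mu j).im)
    rw [abs_mul, abs_of_pos hl, abs_neg, sub_neg_eq_add] at h1
    nlinarith [h.gamma_im j]

lemma Regular.xi_eq (h : S.Regular A T) {z : ℂ} (hz : A ≤ z.re ∨ T ≤ |z.im|) :
    S.xi z = S.G z * S.H z := by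
  have hp : ∀ i, z ≠ S.pole i := fun i hi => by
    have := h.one_le_norm_sub_pole hz i
    rw [hi, sub_self, norm_zero] at this
    linarith
  rw [S.hxiEq z hp, S.hGF z hp, H]
  · ring
  · intro j k hk
    have := h.good hz j
    rw [hk] at this
    have h1 : (0 : ℝ) ≤ k := Nat.cast_nonneg k
    rcases this with h2 | h2
    · simp at h2
      linarith
    · norm_num at h2

lemma Regular.H_ne_zero (h : S.Regular A T) {z : ℂ} (hz : A ≤ z.re ∨ T ≤ |z.im|) :
    S.H z ≠ 0 := by
  refine mul_ne_zero (mul_ne_zero ?_ (Finset.prod_ne_zero_iff.mpr fun j _ =>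
    Gamma_ne_zero_of_good (h.good hz j))) (Finset.prod_ne_zero_iff.mpr fun i _ => ?_)
  · simp [Complex.cpow_eq_zero_iff, S.hQ.ne']
  · split_ifs
    · refine pow_ne_zero _ (norm_pos_iff.mp ?_)
      linarith [h.one_le_norm_reflect_sub_pole hz i]
    · exact one_ne_zero

end SSF

namespace SSF

variable {σ0 σ1 : ℝ} {S : SSF σ0 σ1} {A T : ℝ}

lemma norm_le_of_one_le {u v : ℂ} {K : ℝ} (h : ‖u - v‖ ≤ K) (hv : 1 ≤ ‖v‖) :
    ‖u‖ ≤ (1 + K) * ‖v‖ := by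
  have h1 := norm_sub_norm_le u v
  have hK : 0 ≤ K := (norm_nonneg _).trans h
  nlinarith

lemma norm_cpow_le_of_norm_sub_le {Q : ℝ} (hQ : 0 < Q) {K : ℝ} {z z₀ : ℂ} (h : ‖z - z₀‖ ≤ K) :
    ‖(Q : ℂ) ^ z‖ ≤ Real.exp (|Real.log Q| * K) * ‖(Q : ℂ) ^ z₀‖ := by
  rw [Complex.norm_cpow_eq_rpow_re_of_pos hQ, Complex.norm_cpow_eq_rpow_re_of_pos hQ,
    Real.rpow_def_of_pos hQ, Real.rpow_def_of_pos hQ, ← Real.exp_add]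
  refine Real.exp_le_exp.mpr ?_
  have h1 : |z.re - z₀.re| ≤ K := by
    simpa using (Complex.abs_re_le_norm (z - z₀)).trans h
  have h2 := mul_le_mul_of_nonneg_left h1 (abs_nonneg (Real.log Q))
  rw [← abs_mul] at h2
  linarith [le_abs_self (Real.log Q * (z.re - z₀.re))]

lemma two_add_norm_linear_le {l : ℝ} (hl : 0 < l) (b z : ℂ) :
    2 + ‖(l : ℂ) * z + b‖ ≤ (1 + l + ‖b‖) * (2 + ‖z‖) := by
  have h1 := norm_add_le ((l : ℂ) * z) b
  rw [norm_mul, Complex.norm_real, Real.norm_of_nonneg hl.le] at h1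
  nlinarith [norm_nonneg z, norm_nonneg b, mul_nonneg (norm_nonneg z) (norm_nonneg b)]

lemma Regular.polyLE_Gamma (h : S.Regular A T) (K : ℝ) (j : Fin S.r) :
    PolyLE (fun p : ℂ × ℂ => ‖p.1‖)
      {p | p.1 ∈ region σ1 A T ∧ p.2 ∈ region σ1 A T ∧ ‖p.2 - p.1‖ ≤ K}
      (fun p => Complex.Gamma ((S.lam j : ℂ) * p.2 + S.mu j))
      (fun p => Complex.Gamma ((S.lam j : ℂ) * p.1 + S.mu j)) := by
  have hl := S.hlam j
  obtain ⟨C, k, hC, hCk⟩ := exists_norm_Gamma_le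
    (S.lam j * (A - σ1) + |(S.mu j).re|) (S.lam j * K)
  refine PolyLE.of_const_mul (fun p => norm_nonneg _) (C * (1 + S.lam j + ‖S.mu j‖) ^ k) k ?_
  rintro ⟨z₀, z⟩ ⟨h1, h2, h3⟩
  dsimp only at h1 h2 h3 ⊢
  refine (hCk _ _ (h.good h1.2 j) (h.good h2.2 j) ?_ ?_).trans ?_
  · simp
    nlinarith [h2.1, neg_abs_le (S.mu j).re]
  · rw [add_sub_add_right_eq_sub, ← mul_sub, norm_mul, Complex.norm_real,
      Real.norm_of_nonneg hl.le]
    gcongr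
  · rw [mul_assoc C ((_ : ℝ) ^ k) ((_ : ℝ) ^ k), ← mul_pow]
    gcongr
    exact two_add_norm_linear_le hl _ _

lemma Regular.exists_norm_H_le (h : S.Regular A T) (K : ℝ) : ∃ k : ℕ, ∀ z₀ ∈ region σ1 A T,
    ∀ z ∈ region σ1 A T, ‖z - z₀‖ ≤ K → ‖S.H z‖ ≤ (2 + ‖z₀‖) ^ k * ‖S.H z₀‖ := by
  have hN : ∀ p : ℂ × ℂ, 0 ≤ ‖p.1‖ := fun p => norm_nonneg _
  have key : PolyLE (fun p : ℂ × ℂ => ‖p.1‖)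
      {p | p.1 ∈ region σ1 A T ∧ p.2 ∈ region σ1 A T ∧ ‖p.2 - p.1‖ ≤ K}
      (fun p => S.H p.2) (fun p => S.H p.1) := by
    unfold H
    refine ((PolyLE.of_const hN _ fun p hp => norm_cpow_le_of_norm_sub_le S.hQ hp.2.2).mul hN
      (PolyLE.prod _ hN fun j _ => h.polyLE_Gamma K j)).mul hN (PolyLE.prod _ hN fun i _ => ?_)
    split_ifs
    · refine PolyLE.pow hN (PolyLE.of_const hN (1 + K) fun p hp => norm_le_of_one_le ?_
        (h.one_le_norm_reflect_sub_pole hp.1.2 i)) _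
      rw [sub_sub_sub_cancel_right, sub_sub_sub_cancel_left, norm_sub_rev]
      exact hp.2.2
    · exact PolyLE.of_const hN 1 (by simp)
  obtain ⟨k, hk⟩ := key
  exact ⟨k, fun z₀ h1 z h2 h3 => hk (z₀, z) ⟨h1, h2, h3⟩⟩

lemma norm_le_two_add_norm_mul {u : ℂ} (z : ℂ) {b : ℝ} (hb : 0 ≤ b) (hu : ‖u‖ ≤ ‖z‖ + b) :
    ‖u‖ ≤ (1 + b) * (2 + ‖z‖) := by
  nlinarith [norm_nonneg z, mul_nonneg hb (norm_nonneg z)]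

lemma Regular.exists_norm_H_le_conj (h : S.Regular A T) : ∃ k : ℕ, ∀ z : ℂ, A ≤ z.re →
    ‖S.H z‖ ≤ (2 + ‖z‖) ^ k * ‖S.H ((starRingEnd ℂ) z)‖ := by
  have hN : ∀ z : ℂ, 0 ≤ ‖z‖ := fun z => norm_nonneg _
  have key : PolyLE (fun z : ℂ => ‖z‖) {z | A ≤ z.re}
      (fun z => S.H z) (fun z => S.H ((starRingEnd ℂ) z)) := by
    unfold H
    refine ((PolyLE.of_const hN 1 fun z _ => ?_).mul hN
      (PolyLE.prod _ hN fun j _ => ?_)).mul hN (PolyLE.prod _ hN fun i _ => ?_)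
    · simp [Complex.norm_cpow_eq_rpow_re_of_pos S.hQ]
    · obtain ⟨C, k, hC, hCk⟩ := exists_norm_Gamma_le (-1) (2 * ‖S.mu j‖)
      refine PolyLE.of_const_mul hN (C * (1 + S.lam j + ‖S.mu j‖) ^ k) k fun z hz => ?_
      have hz' : A ≤ ((starRingEnd ℂ) z).re := by simpa using hz
      have e : ‖Complex.Gamma ((S.lam j : ℂ) * (starRingEnd ℂ) z + S.mu j)‖ =
          ‖Complex.Gamma ((S.lam j : ℂ) * z + (starRingEnd ℂ) (S.mu j))‖ := by
        rw [← Complex.norm_conj, ← Complex.Gamma_conj]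
        simp
      have g1 : 1 ≤ ((S.lam j : ℂ) * z + S.mu j).re := by
        have := h.gamma_re j
        simp
        nlinarith [S.hlam j, Set.mem_ofPred.mp hz]
      have g2 : 1 ≤ ((S.lam j : ℂ) * z + (starRingEnd ℂ) (S.mu j)).re := by
        simpa using g1
      rw [e]
      refine (hCk _ _ (Or.inl g2) (Or.inl g1) (by linarith) ?_).trans ?_
      · rw [add_sub_add_left_eq_sub, two_mul]
        refine (norm_sub_le _ _).trans_eq ?_
        rw [Complex.norm_conj]
      · rw [mul_assoc C ((_ : ℝ) ^ k) ((_ : ℝ) ^ k), ← mul_pow]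
        gcongr
        simpa using two_add_norm_linear_le (S.hlam j) ((starRingEnd ℂ) (S.mu j)) z
    · split_ifs
      · refine PolyLE.pow hN (PolyLE.of_const_mul hN (1 + ‖(σ1 : ℂ)‖ + ‖S.pole i‖) 1
          fun z hz => ?_) _
        have hz' : A ≤ ((starRingEnd ℂ) z).re := by simpa using hz
        have h1 := h.one_le_norm_reflect_sub_pole (Or.inl hz') i
        rw [pow_one]
        refine le_trans ?_ (le_mul_of_one_le_right (by positivity) h1)
        rw [add_assoc]
        refine norm_le_two_add_norm_mul z (by positivity) ?_
        have h2 := norm_sub_le ((σ1 : ℂ) - z) ((starRingEnd ℂ) (S.pole i))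
        have h3 := norm_sub_le (σ1 : ℂ) z
        rw [Complex.norm_conj] at h2
        linarith
      · exact PolyLE.of_const hN 1 (by simp)
  exact key

lemma exists_norm_prod_le (S : SSF σ0 σ1) : ∃ k : ℕ, ∀ z : ℂ,
    ‖∏ i, (z - S.pole i) ^ S.m i‖ ≤ (2 + ‖z‖) ^ k := by
  have hN : ∀ z : ℂ, 0 ≤ ‖z‖ := fun z => norm_nonneg _
  have key : PolyLE (fun z : ℂ => ‖z‖) Set.univ
      (fun z => ∏ i, (z - S.pole i) ^ S.m i) (fun z => ∏ i, (1 : ℂ) ^ S.m i) := by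
    refine PolyLE.prod _ hN fun i _ => PolyLE.pow hN
      (PolyLE.of_const_mul hN (1 + ‖S.pole i‖) 1 fun z _ => ?_) _
    simpa using norm_le_two_add_norm_mul z (norm_nonneg (S.pole i)) (norm_sub_le _ _)
  obtain ⟨k, hk⟩ := key
  exact ⟨k, fun z => by simpa using hk z trivial⟩

lemma Regular.norm_G_eq (h : S.Regular A T) {z : ℂ} (hz : A ≤ z.re ∨ T ≤ |z.im|) :
    ‖S.G z‖ = ‖∏ i, (z - S.pole i) ^ S.m i‖ * ‖S.F z‖ := by
  rw [S.hGF z, norm_mul]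
  intro i hi
  have := h.one_le_norm_sub_pole hz i
  rw [hi, sub_self, norm_zero] at this
  linarith

lemma Regular.one_le_norm_prod (h : S.Regular A T) {z : ℂ} (hz : A ≤ z.re ∨ T ≤ |z.im|) :
    1 ≤ ‖∏ i, (z - S.pole i) ^ S.m i‖ := by
  rw [norm_prod]
  rw [← Finset.prod_const_one (s := Finset.univ) (ι := Fin S.N)]
  refine Finset.prod_le_prod (fun _ _ => zero_le_one) fun i _ => ?_
  rw [norm_pow]
  exact one_le_pow₀ (h.one_le_norm_sub_pole hz i)

end SSF

section PhragmenLindelofPolynomial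

lemma norm_le_of_le_re_of_re_le {z : ℂ} {a b : ℝ} (ha : a ≤ z.re) (hb : z.re ≤ b) :
    ‖z‖ ≤ |a| + |b| + |z.im| := by
  refine (Complex.norm_le_abs_re_add_abs_im z).trans ?_
  gcongr
  exact abs_le.mpr ⟨by linarith [neg_abs_le a, abs_nonneg b],
    by linarith [le_abs_self b, abs_nonneg a]⟩

/-- Finite order forces admissible growth in a vertical strip. -/
lemma exists_growth_in_strip {g : ℂ → ℂ} (hg : ∃ c B : ℝ, ∀ s : ℂ, ‖g s‖ ≤ c * Real.exp (‖s‖ ^ B))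
    (a b : ℝ) {e : ℝ} (he : 0 < e) :
    ∃ C R : ℝ, ∀ z : ℂ, a ≤ z.re → z.re ≤ b → R ≤ |z.im| →
      ‖g z‖ ≤ C * Real.exp (1 * Real.exp (e * |z.im|)) := by
  obtain ⟨c, B, hcB⟩ := hg
  obtain ⟨n, hn⟩ := exists_nat_ge B
  have h1 := ((isLittleO_pow_exp_pos_mul_atTop n he).const_mul_left ((2 : ℝ) ^ n)).bound
    (one_pos : (0 : ℝ) < 1)
  obtain ⟨R, hR⟩ := eventually_atTop.mp h1
  refine ⟨|c|, max (max R 1) (|a| + |b|), fun z ha hb hz => ?_⟩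
  have hz1 : R ≤ |z.im| := (le_max_left _ _).trans ((le_max_left _ _).trans hz)
  have hz2 : 1 ≤ |z.im| := (le_max_right _ _).trans ((le_max_left _ _).trans hz)
  have hz3 : |a| + |b| ≤ |z.im| := (le_max_right _ _).trans hz
  have hnorm1 : 1 ≤ ‖z‖ := hz2.trans (Complex.abs_im_le_norm z)
  refine (hcB z).trans (mul_le_mul (le_abs_self c) (Real.exp_le_exp.mpr ?_) (Real.exp_pos _).le
    (abs_nonneg c))
  calc ‖z‖ ^ B ≤ ‖z‖ ^ (n : ℝ) := Real.rpow_le_rpow_of_exponent_le hnorm1 hn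
    _ = ‖z‖ ^ n := Real.rpow_natCast _ _
    _ ≤ (2 * |z.im|) ^ n := by
      gcongr
      linarith [norm_le_of_le_re_of_re_le ha hb]
    _ ≤ 1 * Real.exp (e * |z.im|) := by
      rw [mul_pow]
      have := hR _ hz1
      rw [Real.norm_of_nonneg (by positivity), Real.norm_of_nonneg (by positivity)] at this
      exact this

lemma exists_bound_on_line {g : ℂ → ℂ} (hg : Continuous g) {a T : ℝ}
    (h : PolyLE (fun z : ℂ => ‖z‖) {z | z.re = a ∧ T ≤ |z.im|} g (fun _ => 1)) :
    PolyLE (fun z : ℂ => ‖z‖) {z | z.re = a} g (fun _ => 1) := by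
  obtain ⟨k, hk⟩ := h
  have hc : IsCompact (Metric.closedBall (0 : ℂ) (|a| + |T|)) := isCompact_closedBall _ _
  obtain ⟨C, hC⟩ := hc.bddAbove_image hg.norm.continuousOn
  refine PolyLE.of_const_mul (fun z => norm_nonneg _) (max C 1) k fun z hz => ?_
  have hz' : z.re = a := hz
  have h1 : (1 : ℝ) ≤ (2 + ‖z‖) ^ k := one_le_pow₀ (by linarith [norm_nonneg z])
  rcases le_or_gt T |z.im| with h2 | h2
  · refine (hk z ⟨hz, h2⟩).trans ?_
    simp only [norm_one, mul_one]
    exact le_mul_of_one_le_left (by positivity) (le_max_right _ _)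
  · have h3 : ‖g z‖ ≤ C := hC (Set.mem_image_of_mem (fun w => ‖g w‖) (by
      rw [Metric.mem_closedBall, dist_zero_right]
      refine (Complex.norm_le_abs_re_add_abs_im z).trans ?_
      rw [hz']
      linarith [le_abs_self T]))
    simp only [norm_one, mul_one]
    exact h3.trans ((le_max_left C 1).trans (le_mul_of_one_le_right
      (zero_le_one.trans (le_max_right _ _)) h1))

/-- An entire function of finite order which is polynomially bounded on both edges of a vertical
strip is polynomially bounded inside. -/
lemma PolyLE.strip {g : ℂ → ℂ} (hg : Differentiable ℂ g)
    (hord : ∃ c B : ℝ, ∀ s : ℂ, ‖g s‖ ≤ c * Real.exp (‖s‖ ^ B)) {a b : ℝ} (hab : a < b)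
    (ha : PolyLE (fun z : ℂ => ‖z‖) {z | z.re = a} g (fun _ => 1))
    (hb : PolyLE (fun z : ℂ => ‖z‖) {z | z.re = b} g (fun _ => 1)) :
    PolyLE (fun z : ℂ => ‖z‖) {z | a ≤ z.re ∧ z.re ≤ b} g (fun _ => 1) := by
  obtain ⟨k₁, hk₁⟩ := ha
  obtain ⟨k₂, hk₂⟩ := hb
  set k := max k₁ k₂
  have hpow : ∀ (z : ℂ) (j : ℕ), j ≤ k → (2 + ‖z‖) ^ j ≤ (2 + ‖z‖) ^ k := fun z j hj =>
    pow_le_pow_right₀ (by linarith [norm_nonneg z]) hj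
  set p : ℂ := ((a - 1 : ℝ) : ℂ) with hp
  have hzp : ∀ z : ℂ, a ≤ z.re → 1 ≤ ‖z - p‖ := fun z hz => by
    have := (le_abs_self _).trans (Complex.abs_re_le_norm (z - p))
    have e : (z - p).re = z.re - (a - 1) := by simp [hp]
    linarith
  have hne : ∀ z : ℂ, a ≤ z.re → z - p ≠ 0 := fun z hz => norm_pos_iff.mp (by linarith [hzp z hz])
  have hedge : ∀ z : ℂ, a ≤ z.re → ‖g z‖ ≤ (2 + ‖z‖) ^ k →
      ‖g z / (z - p) ^ k‖ ≤ (3 + ‖p‖) ^ k := by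
    intro z hz hgz
    have h1 := hzp z hz
    rw [norm_div, norm_pow, div_le_iff₀ (by positivity), ← mul_pow]
    refine hgz.trans ?_
    gcongr
    have h2 := norm_sub_norm_le z p
    nlinarith [norm_nonneg p]
  obtain ⟨C, R, hCR⟩ := exists_growth_in_strip hord a b
    (e := π / (b - a) / 2) (by have := sub_pos.mpr hab; positivity)
  have hmain : ∀ z : ℂ, a ≤ z.re → z.re ≤ b → ‖g z / (z - p) ^ k‖ ≤ (3 + ‖p‖) ^ k := by
    intro z hz1 hz2
    refine PhragmenLindelof.vertical_strip (a := a) (b := b) (f := fun z => g z / (z - p) ^ k)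
      ?_ ⟨π / (b - a) / 2, ?_, 1, ?_⟩ ?_ ?_ hz1 hz2
    · refine DifferentiableOn.diffContOnCl fun w hw => ?_
      have hw' : a ≤ w.re := by
        rw [Complex.closure_preimage_re, closure_Ioo hab.ne] at hw
        exact hw.1
      have hd : DifferentiableAt ℂ (fun z => (z - p) ^ k) w := by fun_prop
      exact ((hg w).fun_div hd (pow_ne_zero k (hne w hw'))).differentiableWithinAt
    · have := sub_pos.mpr hab
      exact half_lt_self (by positivity)
    · refine Asymptotics.IsBigO.of_bound C ?_
      have e1 : ∀ᶠ w : ℂ in comap (_root_.abs ∘ Complex.im) atTop, R ≤ |w.im| :=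
        tendsto_comap.eventually (eventually_ge_atTop R)
      filter_upwards [e1.filter_mono inf_le_left,
        mem_inf_of_right (mem_principal_self (Complex.re ⁻¹' Set.Ioo a b))] with w hw1 hw2
      rw [Real.norm_of_nonneg (Real.exp_pos _).le, norm_div, norm_pow]
      exact (div_le_self (norm_nonneg _) (one_le_pow₀ (hzp w hw2.1.le))).trans
        (hCR w hw2.1.le hw2.2.le hw1)
    · intro w hw
      refine hedge w hw.ge ((hk₁ w hw).trans ?_)
      simpa using hpow w _ (le_max_left _ _)
    · intro w hw
      refine hedge w (hab.le.trans hw.ge) ((hk₂ w hw).trans ?_)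
      simpa using hpow w _ (le_max_right _ _)
  refine PolyLE.of_const_mul (fun z => norm_nonneg _) ((3 + ‖p‖) ^ k * (1 + ‖p‖) ^ k) k
    fun z hz => ?_
  have h1 := hmain z hz.1 hz.2
  have h2 := hzp z hz.1
  rw [norm_div, norm_pow, div_le_iff₀ (by positivity)] at h1
  refine h1.trans ?_
  rw [norm_one, mul_one, mul_assoc, ← mul_pow (1 + ‖p‖)]
  gcongr
  refine (norm_sub_le z p).trans ?_
  nlinarith [norm_nonneg p, norm_nonneg z, mul_nonneg (norm_nonneg p) (norm_nonneg z)]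

end PhragmenLindelofPolynomial

namespace SSF

variable {σ0 σ1 : ℝ} {S : SSF σ0 σ1} {A T c C : ℝ}

lemma norm_xi_reflect (S : SSF σ0 σ1) (z : ℂ) :
    ‖S.xi ((σ1 : ℂ) - (starRingEnd ℂ) z)‖ = ‖S.xi z‖ := by
  rw [S.hFE z, norm_mul, S.hω, one_mul, Complex.norm_conj]

lemma Regular.polyLE_G_right (h : S.Regular A T) (hF : ∀ z : ℂ, A ≤ z.re → ‖S.F z‖ ≤ C) :
    PolyLE (fun z : ℂ => ‖z‖) {z | A ≤ z.re} S.G (fun _ => 1) := by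
  obtain ⟨k, hk⟩ := exists_norm_prod_le S
  refine PolyLE.of_const_mul (fun z => norm_nonneg _) C k fun z hz => ?_
  rw [h.norm_G_eq (Or.inl hz), norm_one, mul_one, mul_comm]
  exact mul_le_mul (hF z hz) (hk z) (norm_nonneg _) ((norm_nonneg _).trans (hF z hz))

lemma Regular.le_norm_G (h : S.Regular A T) (hF : ∀ z : ℂ, A ≤ z.re → c ≤ ‖S.F z‖) {z : ℂ}
    (hz : A ≤ z.re) : c ≤ ‖S.G z‖ := by
  rw [h.norm_G_eq (Or.inl hz)]
  exact (hF z hz).trans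
    (le_mul_of_one_le_left (norm_nonneg _) (h.one_le_norm_prod (Or.inl hz)))

lemma Regular.mem_region (h : S.Regular A T) {z : ℂ} (hz : A ≤ z.re) : z ∈ region σ1 A T :=
  ⟨by linarith [h.one_le, h.sigma_le], Or.inl hz⟩

/-- On the left edge the functional equation transfers the bound from the right edge. -/
lemma Regular.polyLE_G_left (h : S.Regular A T) (hF : ∀ z : ℂ, A ≤ z.re → ‖S.F z‖ ≤ C) :
    PolyLE (fun z : ℂ => ‖z‖) {z | z.re = σ1 - A ∧ T ≤ |z.im|} S.G (fun _ => 1) := by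
  obtain ⟨k, hk⟩ := h.polyLE_G_right hF
  obtain ⟨l, hl⟩ := h.exists_norm_H_le (2 * A - σ1)
  have hσ := S.hσ1pos
  refine PolyLE.of_const_mul (fun z => norm_nonneg _) ((1 + σ1) ^ k) (k + l) fun z hz => ?_
  obtain ⟨hz1, hz2⟩ := hz
  set w : ℂ := (σ1 : ℂ) - (starRingEnd ℂ) z with hw
  have hwre : A ≤ w.re := by simp [hw, hz1]
  have hzreg : z ∈ region σ1 A T := ⟨hz1.ge, Or.inr hz2⟩
  have hwz : ‖w - z‖ ≤ 2 * A - σ1 := by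
    have e : w - z = ((2 * A - σ1 : ℝ) : ℂ) := by
      apply Complex.ext
      · simp [hw, hz1]; ring
      · simp [hw]
    rw [e, Complex.norm_real, Real.norm_of_nonneg (by linarith [h.sigma_le, h.one_le])]
  have hHw := hl z hzreg w (h.mem_region hwre) hwz
  have hHz : 0 < ‖S.H z‖ := norm_pos_iff.mpr (h.H_ne_zero (Or.inr hz2))
  have hxi := S.norm_xi_reflect z
  rw [← hw, h.xi_eq (Or.inl hwre), h.xi_eq (Or.inr hz2), norm_mul, norm_mul] at hxi
  have hGw := hk w hwre
  simp only [norm_one, mul_one] at hGw ⊢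
  have hwn : 2 + ‖w‖ ≤ (1 + σ1) * (2 + ‖z‖) := by
    have := norm_sub_le (σ1 : ℂ) ((starRingEnd ℂ) z)
    rw [Complex.norm_conj, Complex.norm_real, Real.norm_of_nonneg hσ.le] at this
    nlinarith [norm_nonneg z, mul_nonneg hσ.le (norm_nonneg z)]
  refine le_of_mul_le_mul_right ?_ hHz
  calc ‖S.G z‖ * ‖S.H z‖ = ‖S.G w‖ * ‖S.H w‖ := hxi.symm
    _ ≤ ((1 + σ1) * (2 + ‖z‖)) ^ k * ((2 + ‖z‖) ^ l * ‖S.H z‖) := by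
      gcongr
      exact hGw.trans (by gcongr)
    _ = _ := by rw [mul_pow, pow_add]; ring

lemma Regular.polyLE_G (h : S.Regular A T) (hF : ∀ z : ℂ, A ≤ z.re → ‖S.F z‖ ≤ C) :
    PolyLE (fun z : ℂ => ‖z‖) {z | σ1 - A ≤ z.re} S.G (fun _ => 1) := by
  have hr := h.polyLE_G_right hF
  have hs := PolyLE.strip S.hGdiff S.hGord (a := σ1 - A) (b := A)
    (by linarith [h.sigma_le, h.one_le])
    (exists_bound_on_line S.hGdiff.continuous (h.polyLE_G_left hF))
    (hr.imp fun k hk z hz => hk z (Set.mem_ofPred.mp hz).ge)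
  obtain ⟨k, hk⟩ := hr
  obtain ⟨l, hl⟩ := hs
  refine ⟨max k l, fun z hz => ?_⟩
  have h1 : (1 : ℝ) ≤ 2 + ‖z‖ := by linarith [norm_nonneg z]
  rcases le_total A z.re with hA | hA
  · refine (hk z hA).trans ?_
    dsimp only
    gcongr
    exact le_max_left _ _
  · refine (hl z ⟨hz, hA⟩).trans ?_
    dsimp only
    gcongr
    exact le_max_right _ _

lemma Regular.xi_ne_zero (h : S.Regular A T) (hc : 0 < c) (hF : ∀ z : ℂ, A ≤ z.re → c ≤ ‖S.F z‖)
    {z : ℂ} (hz : A ≤ z.re) : S.xi z ≠ 0 := by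
  rw [h.xi_eq (Or.inl hz)]
  exact mul_ne_zero (norm_pos_iff.mp (hc.trans_le (h.le_norm_G hF hz))) (h.H_ne_zero (Or.inl hz))

lemma Regular.ratio_region (h : S.Regular A T) (hc : 0 < c)
    (hF : ∀ z : ℂ, A ≤ z.re → c ≤ ‖S.F z‖ ∧ ‖S.F z‖ ≤ C) (K : ℝ) :
    ∃ k : ℕ, ∀ z₀ z : ℂ, A ≤ z₀.re → z ∈ region σ1 A T → ‖z - z₀‖ ≤ K →
      ‖S.xi z‖ ≤ (2 + ‖z₀‖) ^ k * ‖S.xi z₀‖ := by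
  obtain ⟨k, hk⟩ := h.polyLE_G fun z hz => (hF z hz).2
  obtain ⟨l, hl⟩ := h.exists_norm_H_le K
  have key : PolyLE (fun p : ℂ × ℂ => ‖p.1‖)
      {p | A ≤ p.1.re ∧ p.2 ∈ region σ1 A T ∧ ‖p.2 - p.1‖ ≤ K}
      (fun p => S.xi p.2) (fun p => S.xi p.1) := by
    refine PolyLE.of_const_mul (fun p => norm_nonneg _) ((1 + K) ^ k * c⁻¹) (k + l) ?_
    rintro ⟨z₀, z⟩ ⟨h1, h2, h3⟩
    dsimp only at h1 h2 h3 ⊢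
    have hG := hk z h2.1
    have hG₀ := h.le_norm_G (fun z hz => (hF z hz).1) h1
    have hG₀' : 1 ≤ c⁻¹ * ‖S.G z₀‖ := by
      rwa [inv_mul_eq_div, one_le_div hc]
    have hH := hl z₀ (h.mem_region h1) z h2 h3
    have hK : 0 ≤ K := (norm_nonneg _).trans h3
    have hz : 2 + ‖z‖ ≤ (1 + K) * (2 + ‖z₀‖) := by
      have := norm_sub_norm_le z z₀
      nlinarith [norm_nonneg z₀, mul_nonneg hK (norm_nonneg z₀)]
    rw [h.xi_eq h2.2, h.xi_eq (Or.inl h1), norm_mul, norm_mul]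
    simp only [norm_one, mul_one] at hG
    calc ‖S.G z‖ * ‖S.H z‖
        ≤ (((1 + K) * (2 + ‖z₀‖)) ^ k * (c⁻¹ * ‖S.G z₀‖)) * ((2 + ‖z₀‖) ^ l * ‖S.H z₀‖) := by
          gcongr
          exact (hG.trans (by gcongr)).trans (le_mul_of_one_le_right (by positivity) hG₀')
      _ = _ := by rw [mul_pow, pow_add]; ring
  obtain ⟨j, hj⟩ := key
  exact ⟨j, fun z₀ z h1 h2 h3 => hj (z₀, z) ⟨h1, h2, h3⟩⟩

lemma Regular.ratio_right (h : S.Regular A T) (hc : 0 < c)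
    (hF : ∀ z : ℂ, A ≤ z.re → c ≤ ‖S.F z‖ ∧ ‖S.F z‖ ≤ C) (K : ℝ) :
    ∃ k : ℕ, ∀ z₀ z : ℂ, A ≤ z₀.re → σ1 - A ≤ z.re → ‖z - z₀‖ ≤ K →
      ‖S.xi z‖ ≤ (2 + ‖z₀‖) ^ k * ‖S.xi z₀‖ := by
  obtain ⟨k, hk⟩ := h.ratio_region hc hF K
  set R := |σ1 - A| + |A| + T with hR
  have hcont := S.hxiDiff.continuous
  obtain ⟨C₁, hC₁⟩ := (isCompact_closedBall (0 : ℂ) R).bddAbove_image hcont.norm.continuousOn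
  have hD : IsCompact (Metric.closedBall (0 : ℂ) (R + K) ∩ {w | A ≤ w.re}) :=
    (isCompact_closedBall _ _).inter_right (isClosed_le continuous_const Complex.continuous_re)
  obtain ⟨C₂, hC₂⟩ := hD.bddAbove_image (f := fun w => ‖(S.xi w)⁻¹‖)
    (hcont.continuousOn.inv₀ fun w hw => h.xi_ne_zero hc (fun z hz => (hF z hz).1) hw.2).norm
  obtain ⟨l, hl⟩ := exists_le_two_add_pow (max C₁ 1 * max C₂ 1)
  refine ⟨max k l, fun z₀ z h1 h2 h3 => ?_⟩
  have hb : (1 : ℝ) ≤ 2 + ‖z₀‖ := by linarith [norm_nonneg z₀]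
  by_cases hz : z ∈ region σ1 A T
  · refine (hk z₀ z h1 hz h3).trans ?_
    gcongr
    exact le_max_left _ _
  · have hz' : z.re < A ∧ |z.im| < T := by
      simpa only [region, Set.mem_ofPred_eq, h2, true_and, not_or, not_le] using hz
    have hzR : ‖z‖ ≤ R := (norm_le_of_le_re_of_re_le h2 hz'.1.le).trans (by linarith)
    have hz₀R : ‖z₀‖ ≤ R + K := by
      have := norm_sub_norm_le z₀ z
      rw [norm_sub_rev] at this
      linarith
    have b1 : ‖S.xi z‖ ≤ C₁ := hC₁ (Set.mem_image_of_mem (fun w => ‖S.xi w‖) (by simpa using hzR))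
    have b2 : ‖(S.xi z₀)⁻¹‖ ≤ C₂ := hC₂ (Set.mem_image_of_mem (fun w => ‖(S.xi w)⁻¹‖)
      ⟨by simpa using hz₀R, h1⟩)
    have hxi₀ : 0 < ‖S.xi z₀‖ :=
      norm_pos_iff.mpr (h.xi_ne_zero hc (fun z hz => (hF z hz).1) h1)
    have b3 : 1 ≤ max C₂ 1 * ‖S.xi z₀‖ := by
      rw [norm_inv] at b2
      calc (1 : ℝ) = ‖S.xi z₀‖⁻¹ * ‖S.xi z₀‖ := (inv_mul_cancel₀ hxi₀.ne').symm
        _ ≤ _ := by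
          gcongr
          exact b2.trans (le_max_left _ _)
    calc ‖S.xi z‖ ≤ max C₁ 1 * (max C₂ 1 * ‖S.xi z₀‖) :=
          (b1.trans (le_max_left _ _)).trans (le_mul_of_one_le_right (by positivity) b3)
      _ = (max C₁ 1 * max C₂ 1) * ‖S.xi z₀‖ := by ring
      _ ≤ (2 + ‖z₀‖) ^ l * ‖S.xi z₀‖ := by
        gcongr
        exact hl _ (norm_nonneg _)
      _ ≤ _ := by
        gcongr
        exact le_max_right _ _

lemma Regular.ratio (h : S.Regular A T) (hc : 0 < c)
    (hF : ∀ z : ℂ, A ≤ z.re → c ≤ ‖S.F z‖ ∧ ‖S.F z‖ ≤ C) (K : ℝ) :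
    ∃ k : ℕ, ∀ z₀ z : ℂ, A ≤ z₀.re → ‖z - z₀‖ ≤ K →
      ‖S.xi z‖ ≤ (2 + ‖z₀‖) ^ k * ‖S.xi z₀‖ := by
  obtain ⟨k, hk⟩ := h.ratio_right hc hF (3 * K + σ1)
  have hσ := S.hσ1pos
  refine ⟨k, fun z₀ z h1 h2 => ?_⟩
  have hK : 0 ≤ K := (norm_nonneg _).trans h2
  rcases le_or_gt (σ1 - A) z.re with h3 | h3
  · exact hk z₀ z h1 h3 (by linarith)
  · rw [← S.norm_xi_reflect z]
    set w : ℂ := (σ1 : ℂ) - (starRingEnd ℂ) z with hw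
    have hre := abs_le.mp ((Complex.abs_re_le_norm (z - z₀)).trans h2)
    simp only [Complex.sub_re] at hre
    have e : w - z = ((σ1 - 2 * z.re : ℝ) : ℂ) := by
      apply Complex.ext
      · simp [hw]; ring
      · simp [hw]
    have hwz : ‖w - z‖ ≤ 2 * K + σ1 := by
      rw [e, Complex.norm_real, Real.norm_eq_abs, abs_le]
      constructor <;> linarith [h.one_le, h.sigma_le]
    refine hk z₀ w h1 ?_ ?_
    · simp [hw]
      linarith [h.one_le, h.sigma_le]
    · have := norm_add_le (w - z) (z - z₀)
      rw [sub_add_sub_cancel] at this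
      linarith

lemma Regular.conj_ratio (h : S.Regular A T) (hc : 0 < c)
    (hF : ∀ z : ℂ, A ≤ z.re → c ≤ ‖S.F z‖ ∧ ‖S.F z‖ ≤ C) :
    ∃ k : ℕ, ∀ z : ℂ, A ≤ z.re → ‖S.xi z‖ ≤ (2 + ‖z‖) ^ k * ‖S.xi ((starRingEnd ℂ) z)‖ := by
  have hN : ∀ z : ℂ, 0 ≤ ‖z‖ := fun z => norm_nonneg _
  have hG : PolyLE (fun z : ℂ => ‖z‖) {z | A ≤ z.re} S.G (fun z => S.G ((starRingEnd ℂ) z)) := by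
    obtain ⟨k, hk⟩ := h.polyLE_G_right fun z hz => (hF z hz).2
    refine PolyLE.of_const_mul hN c⁻¹ k fun z hz => (hk z hz).trans ?_
    have := h.le_norm_G (fun z hz => (hF z hz).1) (z := (starRingEnd ℂ) z) (by simpa using hz)
    rw [norm_one, mul_comm c⁻¹, mul_assoc]
    gcongr
    rwa [inv_mul_eq_div, one_le_div hc]
  obtain ⟨l, hl⟩ := hG.mul hN h.exists_norm_H_le_conj
  refine ⟨l, fun z hz => ?_⟩
  rw [h.xi_eq (Or.inl hz), h.xi_eq (Or.inl (by simpa using hz))]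
  exact hl z hz

lemma coeff_ne_zero (S : SSF σ0 σ1) {s : ℂ} (hs : S.xi s ≠ 0) : S.coeff ≠ 0 := by
  intro h0
  obtain ⟨A, T, h, hA⟩ := S.exists_regular (eventually_gt_atTop σ0)
  have hF : ∀ z : ℂ, A ≤ z.re → S.F z = 0 := fun z hz => by
    have := (S.hasSum_coeff (hA.trans_le hz)).LSeries_eq
    rw [← this, h0, LSeries_zero, Pi.zero_apply]
  have hxi : ∀ z : ℂ, A ≤ z.re → S.xi z = 0 := fun z hz => by
    have := h.norm_G_eq (Or.inl hz)
    rw [hF z hz, norm_zero, mul_zero, norm_eq_zero] at this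
    rw [h.xi_eq (Or.inl hz), this, zero_mul]
  have hev : S.xi =ᶠ[𝓝 ((A + 1 : ℝ) : ℂ)] 0 := by
    filter_upwards [(isOpen_lt continuous_const Complex.continuous_re).mem_nhds
      (show A < (((A + 1 : ℝ) : ℂ)).re by simp)] with z hz
    exact hxi z (le_of_lt hz)
  have := AnalyticOnNhd.eq_of_eventuallyEq (f := S.xi) (g := 0)
    (fun z _ => S.hxiDiff.analyticAt z) (fun z _ => analyticAt_const) hev
  exact hs (by rw [this]; rfl)

lemma exists_temperedFE (S : SSF σ0 σ1) {s : ℂ} (hs : S.xi s ≠ 0) :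
    ∃ A, TemperedFE S.xi σ1 A S.ω := by
  obtain ⟨c, C, hc, hev⟩ := S.eventually_F_bounds (S.coeff_ne_zero hs)
  obtain ⟨A, T, h, hF⟩ := S.exists_regular hev
  exact ⟨A, {
    differentiable := S.hxiDiff
    norm_eq_one := S.hω
    fe := S.hFE
    sigma_pos := S.hσ1pos
    one_le := h.one_le
    sigma_le := h.sigma_le
    ne_zero := fun z hz => h.xi_ne_zero hc (fun z hz => (hF z hz).1) hz
    ratio := h.ratio hc hF
    conj_ratio := h.conj_ratio hc hF }⟩

end SSF

end

/-- For `F ∈ S^♯♭(σ₀,σ₁)` with `0 ∉ Z(F)` and any `s` that is not a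
nontrivial zero, the symmetric limit `lim_{T→∞} ∑_{ρ∈Z(F), |Im ρ|≤T} ord(ρ)/(s−ρ)` exists
and equals `ξ_F'(s)/ξ_F(s)`. -/
theorem logDeriv_xi_eq_zero_sum (σ0 σ1 : ℝ) (S : SSF σ0 σ1)
    (h0 : S.xi 0 ≠ 0) (s : ℂ) (hs : S.xi s ≠ 0) :
    Filter.Tendsto (fun T : ℝ =>
        ∑' ρ : {ρ : ℂ // S.xi ρ = 0 ∧ |ρ.im| ≤ T},
          (zeroOrder S.xi ρ : ℂ) / (s - ρ))
      Filter.atTop (nhds (deriv S.xi s / S.xi s)) := by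
  obtain ⟨A, h⟩ := S.exists_temperedFE h0
  simpa [logDeriv_apply] using h.tendsto_tsum hs

end
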